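/- Suppose (ρ, u) with ρ ∈ L²(0,T; L²(0,L)), ρ ≥ 0, and u ∈ L²(0,T; W_0^{1,2}(0,L)) satisfies the continuity equation ρ_t + (ρu)_x = 0 in the sense of distributions on [0,T)×[0,L] with initial data ρ_0. Then for B(z) = z log z (extended by 0 at z = 0), and for a.e. t ∈ (0,T), ∫_0^L ρ(t) log ρ(t) dx = ∫_0^L ρ_0 log ρ_0 dx − ∫_0^t ∫_0^L ρ u_x dx ds. -/

import Mathlib

open MeasureTheory

namespace CE
open Filter Topology Set

theorem gdct {α : Type*} [MeasurableSpace α] {μ : Measure α}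
    {F G : ℕ → α → ℝ} {f g : α → ℝ}
    (hF : ∀ n, Integrable (F n) μ) (hG : ∀ n, Integrable (G n) μ) (hg : Integrable g μ)
    (hb : ∀ n, ∀ᵐ x ∂μ, |F n x| ≤ G n x)
    (hFl : ∀ᵐ x ∂μ, Tendsto (fun n => F n x) atTop (𝓝 (f x)))
    (hGl : ∀ᵐ x ∂μ, Tendsto (fun n => G n x) atTop (𝓝 (g x)))
    (hI : ∀ n, ∫ x, G n x ∂μ ≤ ∫ x, g x ∂μ) :
    Tendsto (fun n => ∫ x, F n x ∂μ) atTop (𝓝 (∫ x, f x ∂μ)) := by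
  have hb' := ae_all_iff.2 hb
  have hg0 : ∀ᵐ x ∂μ, 0 ≤ g x := by
    filter_upwards [hb', hGl] with x h1 h2
    exact ge_of_tendsto' h2 (fun n => (abs_nonneg _).trans (h1 n))
  have hmin : Tendsto (fun n => ∫ x, min (G n x) (g x) ∂μ) atTop (𝓝 (∫ x, g x ∂μ)) := by
    apply tendsto_integral_of_dominated_convergence g
    · exact fun n => ((hG n).inf hg).aestronglyMeasurable
    · exact hg
    · intro n
      filter_upwards [hb', hg0] with x h1 h2
      have := (abs_nonneg _).trans (h1 n)
      rw [Real.norm_eq_abs, abs_of_nonneg (le_min this h2)]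
      exact min_le_right _ _
    · filter_upwards [hGl] with x h
      simpa using h.min (tendsto_const_nhds (x := g x))
  have hcl : Tendsto (fun n => ∫ x, max (min (F n x) (g x)) (-g x) ∂μ) atTop
      (𝓝 (∫ x, f x ∂μ)) := by
    apply tendsto_integral_of_dominated_convergence g
    · exact fun n => (((hF n).inf hg).sup hg.neg).aestronglyMeasurable
    · exact hg
    · intro n
      filter_upwards [hg0] with x h2
      rw [Real.norm_eq_abs, abs_le]
      exact ⟨le_max_right _ _, max_le (min_le_right _ _) (by linarith)⟩
    · filter_upwards [hFl, hGl, hb'] with x h1 h2 h3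
      have h4 : |f x| ≤ g x := le_of_tendsto_of_tendsto' h1.abs h2 h3
      rw [abs_le] at h4
      have := (h1.min (tendsto_const_nhds (x := g x))).max (tendsto_const_nhds (x := - g x))
      rwa [min_eq_left h4.2, max_eq_left h4.1] at this
  have hdiff : Tendsto (fun n => ∫ x, F n x ∂μ - ∫ x, max (min (F n x) (g x)) (-g x) ∂μ)
      atTop (𝓝 0) := by
    have h0 : Tendsto (fun n => ∫ x, g x ∂μ - ∫ x, min (G n x) (g x) ∂μ) atTop (𝓝 0) := by
      simpa using (tendsto_const_nhds (x := ∫ x, g x ∂μ)).sub hmin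
    refine squeeze_zero_norm (fun n => ?_) h0
    have hcI : ∀ n, Integrable (fun x => max (min (F n x) (g x)) (-g x)) μ :=
      fun n => ((hF n).inf hg).sup hg.neg
    have hmI : ∀ n, Integrable (fun x => min (G n x) (g x)) μ := fun n => (hG n).inf hg
    rw [← integral_sub (hF n) (hcI n)]
    refine (norm_integral_le_integral_norm _).trans ?_
    have h5 : ∫ x, ‖F n x - max (min (F n x) (g x)) (-g x)‖ ∂μ
        ≤ ∫ x, (G n x - min (G n x) (g x)) ∂μ := by
      apply integral_mono_ae ((hF n).sub (hcI n)).norm ((hG n).sub (hmI n))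
      filter_upwards [hb n, hg0] with x h1 h2
      simp only [Real.norm_eq_abs, Pi.sub_apply]
      rw [abs_le] at h1
      rw [abs_le]
      rcases min_cases (G n x) (g x) with h | h <;> rcases min_cases (F n x) (g x) with h' | h' <;>
      rcases max_cases (min (F n x) (g x)) (-g x) with h'' | h'' <;>
      constructor <;> linarith
    rw [integral_sub (hG n) (hmI n)] at h5
    linarith [hI n]
  simpa using hdiff.add hcl

/-- composition of an AC function with a Lipschitz one -/
theorem ac_comp {F b : ℝ → ℝ} {a c K : ℝ} (hF : AbsolutelyContinuousOnInterval F a c)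
    (hb : ∀ x y, |b x - b y| ≤ K * |x - y|) :
    AbsolutelyContinuousOnInterval (fun x => b (F x)) a c := by
  unfold AbsolutelyContinuousOnInterval at *
  have := hF.const_mul K
  rw [mul_zero] at this
  refine squeeze_zero (fun E => Finset.sum_nonneg (fun _ _ => dist_nonneg)) (fun E => ?_) this
  rw [Finset.mul_sum]
  exact Finset.sum_le_sum (fun i _ => by simpa [Real.dist_eq] using hb _ _)

theorem lip_of_deriv {b b' : ℝ → ℝ} {K : ℝ} (hb : ∀ z, HasDerivAt b (b' z) z)
    (hK : ∀ z, |b' z| ≤ K) (x y : ℝ) : |b x - b y| ≤ K * |x - y| := by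
  have := Convex.norm_image_sub_le_of_norm_hasDerivWithin_le (f := b) (f' := b') (C := K)
    (s := univ) (x := y) (y := x) (fun z _ => (hb z).hasDerivWithinAt) (fun z _ => hK z)
    convex_univ (mem_univ _) (mem_univ _)
  simpa using this

/-- chain rule -/
theorem chain_int {b b' k : ℝ → ℝ} {K c a t : ℝ} (hb : ∀ z, HasDerivAt b (b' z) z)
    (hK : ∀ z, |b' z| ≤ K) (hk : IntervalIntegrable k volume a t) :
    b (c + ∫ s in a..t, k s) = b c + ∫ s in a..t, b' (c + ∫ r in a..s, k r) * k s := by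
  have hac : AbsolutelyContinuousOnInterval (fun x => c + ∫ s in a..x, k s) a t := by
    have h1 := hk.absolutelyContinuousOnInterval_intervalIntegral (c := a) (by simp)
    have h2 : AbsolutelyContinuousOnInterval (fun _ : ℝ => c) a t := by
      unfold AbsolutelyContinuousOnInterval; simpa using tendsto_const_nhds
    exact h2.add h1
  have h := (ac_comp hac (lip_of_deriv hb hK)).integral_deriv_eq_sub
  simp only [intervalIntegral.integral_same, add_zero] at h
  rw [← sub_eq_iff_eq_add', ← h]
  apply intervalIntegral.integral_congr_ae
  filter_upwards [hk.ae_hasDerivAt_integral] with x hx hx'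
  have h3 := hx (uIoc_subset_uIcc hx') a (by simp)
  exact ((hb _).comp x (h3.const_add c)).deriv

end CE

namespace CE
open Filter Topology Set

theorem avg_eq_conv (g : ℝ → ℝ) {ε : ℝ} (hε : 0 < ε) :
    (fun x => (∫ y in (x-ε)..x, g y) / ε) =
      convolution (indicator (Ioc 0 ε) (fun _ => ε⁻¹)) g (ContinuousLinearMap.mul ℝ ℝ) volume := by
  funext x
  rw [convolution_def]
  have h1 : (fun t => (ContinuousLinearMap.mul ℝ ℝ) (indicator (Ioc 0 ε) (fun _ => ε⁻¹) t) (g (x - t)))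
    = indicator (Ioc 0 ε) (fun t => ε⁻¹ * g (x - t)) := by
    funext t
    by_cases ht : t ∈ Ioc 0 ε <;> simp [ht]
  rw [h1, integral_indicator measurableSet_Ioc, ← intervalIntegral.integral_of_le hε.le,
    intervalIntegral.integral_const_mul, intervalIntegral.integral_comp_sub_left]
  simp [div_eq_inv_mul]

theorem ind_int {ε : ℝ} : Integrable (indicator (Ioc 0 ε) (fun _ : ℝ => ε⁻¹)) volume := by
  rw [integrable_indicator_iff measurableSet_Ioc]
  exact integrableOn_const (by simp)

theorem avg_int {g : ℝ → ℝ} (hg : Integrable g) {ε : ℝ} (hε : 0 < ε) :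
    Integrable (fun x => (∫ y in (x-ε)..x, g y) / ε) ∧
    ∫ x, (∫ y in (x-ε)..x, g y) / ε = ∫ x, g x := by
  rw [avg_eq_conv g hε]
  refine ⟨ind_int.integrable_convolution _ hg, ?_⟩
  rw [integral_convolution (ContinuousLinearMap.mul ℝ ℝ) ind_int hg,
    integral_indicator measurableSet_Ioc]
  simp [hε.le, hε.ne']

theorem avg_sq_le {f : ℝ → ℝ} (hf : Integrable f) (hf2 : Integrable (fun x => f x ^ 2)) {ε : ℝ}
    (hε : 0 < ε) (x : ℝ) :
    ((∫ y in (x-ε)..x, f y) / ε) ^ 2 ≤ (∫ y in (x-ε)..x, f y ^ 2) / ε := by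
  set c := (∫ y in (x-ε)..x, f y) / ε with hc
  have h1 : 0 ≤ ∫ y in (x-ε)..x, (f y - c) ^ 2 :=
    intervalIntegral.integral_nonneg (by linarith) (fun y _ => sq_nonneg _)
  have h2 : ∫ y in (x-ε)..x, (f y - c) ^ 2
      = (∫ y in (x-ε)..x, f y ^ 2) - 2 * c * (∫ y in (x-ε)..x, f y) + c ^ 2 * ε := by
    have : ∀ y, (f y - c) ^ 2 = f y ^ 2 - 2 * c * f y + c ^ 2 := fun y => by ring
    simp_rw [this]
    have i1 : IntervalIntegrable (fun y => f y ^ 2) volume (x-ε) x := hf2.intervalIntegrable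
    have i2 : IntervalIntegrable (fun y => 2 * c * f y) volume (x-ε) x :=
      (hf.const_mul _).intervalIntegrable
    rw [intervalIntegral.integral_add (i1.sub i2) (by simp),
      intervalIntegral.integral_sub i1 i2, intervalIntegral.integral_const_mul]
    simp [mul_comm]
  have h3 : ∫ y in (x-ε)..x, f y = c * ε := by rw [hc]; field_simp
  rw [h2, h3] at h1
  rw [le_div_iff₀ hε]
  nlinarith

theorem avg_sq_int {f : ℝ → ℝ} (hf : Integrable f) (hf2 : Integrable (fun x => f x ^ 2)) {ε : ℝ}
    (hε : 0 < ε) : Integrable (fun x => ((∫ y in (x-ε)..x, f y) / ε) ^ 2) ∧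
      ∫ x, ((∫ y in (x-ε)..x, f y) / ε) ^ 2 ≤ ∫ x, f x ^ 2 := by
  obtain ⟨i1, e1⟩ := avg_int hf2 hε
  have i2 : Integrable (fun x => ((∫ y in (x-ε)..x, f y) / ε) ^ 2) := by
    refine i1.mono' ((avg_int hf hε).1.aestronglyMeasurable.pow 2) (ae_of_all _ fun x => ?_)
    rw [Real.norm_eq_abs, abs_of_nonneg (sq_nonneg _)]
    exact avg_sq_le hf hf2 hε x
  refine ⟨i2, ?_⟩
  rw [← e1]
  exact integral_mono i2 i1 (avg_sq_le hf hf2 hε)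

theorem eps_tendsto : Tendsto (fun n : ℕ => 1 / ((n : ℝ) + 1)) atTop (𝓝 0) :=
  tendsto_one_div_add_atTop_nhds_zero_nat

theorem avg_tendsto {f : ℝ → ℝ} (hf : Integrable f) :
    ∀ᵐ x, Tendsto (fun n : ℕ => (∫ y in (x - 1 / ((n : ℝ) + 1))..x, f y) / (1 / ((n : ℝ) + 1)))
        atTop (𝓝 (f x)) ∧
      Tendsto (fun n : ℕ => (∫ y in x..(x + 1 / ((n : ℝ) + 1)), f y) / (1 / ((n : ℝ) + 1)))
        atTop (𝓝 (f x)) := by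
  filter_upwards [_root_.LocallyIntegrable.ae_hasDerivAt_integral hf.locallyIntegrable] with x hx
  have h := hasDerivAt_iff_tendsto_slope_zero.1 (hx x)
  have pos : ∀ n : ℕ, (0:ℝ) < 1 / ((n : ℝ) + 1) := fun n => by positivity
  have t1 : Tendsto (fun n : ℕ => 1 / ((n : ℝ) + 1)) atTop (𝓝[≠] 0) :=
    tendsto_nhdsWithin_iff.2 ⟨eps_tendsto, Eventually.of_forall fun n => (pos n).ne'⟩
  have t2 : Tendsto (fun n : ℕ => -(1 / ((n : ℝ) + 1))) atTop (𝓝[≠] 0) :=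
    tendsto_nhdsWithin_iff.2 ⟨by simpa using eps_tendsto.neg,
      Eventually.of_forall fun n => (neg_neg_of_pos (pos n)).ne⟩
  constructor
  · refine (h.comp t2).congr fun n => ?_
    simp only [Function.comp, intervalIntegral.integral_same, sub_zero, smul_eq_mul]
    rw [intervalIntegral.integral_symm, ← sub_eq_add_neg]
    field_simp
  · refine (h.comp t1).congr fun n => ?_
    simp only [Function.comp, intervalIntegral.integral_same, sub_zero, smul_eq_mul]
    exact (div_eq_inv_mul _ _).symm

end CE

namespace CE
open Filter Topology Set

/-- the primitive `v` of the truncated derivative -/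
theorem prim_facts {L : ℝ} (hL : 0 < L) {u ux : ℝ → ℝ} (hu : ∀ x, HasDerivAt u (ux x) x)
    (h0 : u 0 = 0) (h1 : u L = 0) (hux : IntegrableOn ux (Ioo 0 L)) :
    (∀ x ∈ Ioo 0 L, ∫ y in (0:ℝ)..x, indicator (Ioo 0 L) ux y = u x) ∧
    ∫ y in (0:ℝ)..L, indicator (Ioo 0 L) ux y = 0 ∧
    (∀ x ∉ Ioo 0 L, ∫ y in (0:ℝ)..x, indicator (Ioo 0 L) ux y = 0) := by
  have key : ∀ x ∈ Icc 0 L, ∫ y in (0:ℝ)..x, indicator (Ioo 0 L) ux y = u x := by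
    intro x hx
    have e : ∫ y in (0:ℝ)..x, indicator (Ioo 0 L) ux y = ∫ y in (0:ℝ)..x, ux y := by
      rw [intervalIntegral.integral_of_le hx.1, intervalIntegral.integral_of_le hx.1,
        integral_Ioc_eq_integral_Ioo, integral_Ioc_eq_integral_Ioo]
      refine setIntegral_congr_fun measurableSet_Ioo fun y hy => ?_
      have hm : y ∈ Ioo 0 L := ⟨hy.1, hy.2.trans_le hx.2⟩
      simp [indicator_of_mem hm]
    rw [e, intervalIntegral.integral_eq_sub_of_hasDerivAt (fun y _ => hu y), h0, sub_zero]
    rw [intervalIntegrable_iff_integrableOn_Ioo_of_le hx.1]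
    exact hux.mono_set (Ioo_subset_Ioo_right hx.2)
  have hi : Integrable (indicator (Ioo 0 L) ux) := by
    rwa [integrable_indicator_iff measurableSet_Ioo]
  refine ⟨fun x hx => key x ⟨hx.1.le, hx.2.le⟩, by rw [key L ⟨hL.le, le_rfl⟩, h1], ?_⟩
  intro x hx
  rcases le_or_gt x 0 with h | h
  · rw [intervalIntegral.integral_symm, intervalIntegral.integral_of_le h]
    rw [setIntegral_eq_zero_of_forall_eq_zero, neg_zero]
    intro y hy
    exact indicator_of_notMem (fun h' => absurd h'.1 (not_lt.2 hy.2)) ux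
  · have hxL : L ≤ x := by
      by_contra hh
      exact hx ⟨h, not_le.1 hh⟩
    rw [← intervalIntegral.integral_add_adjacent_intervals (b := L) hi.intervalIntegrable
      hi.intervalIntegrable, key L ⟨hL.le, le_rfl⟩, h1, zero_add,
      intervalIntegral.integral_of_le hxL]
    apply setIntegral_eq_zero_of_forall_eq_zero
    intro y hy
    exact indicator_of_notMem (fun h' => absurd h'.2 (not_lt.2 hy.1.le)) ux

theorem avg_cont {r : ℝ → ℝ} (hr : Integrable r) (ε : ℝ) :
    Continuous (fun x => (∫ y in (x-ε)..x, r y) / ε) := by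
  have h : ∀ x, (∫ y in (x-ε)..x, r y) = (∫ y in (0:ℝ)..x, r y) - ∫ y in (0:ℝ)..(x-ε), r y := by
    intro x
    rw [intervalIntegral.integral_interval_sub_left hr.intervalIntegrable hr.intervalIntegrable]
  simp_rw [h]
  have c : Continuous (fun x => ∫ y in (0:ℝ)..x, r y) :=
    intervalIntegral.continuous_primitive (fun _ _ => hr.intervalIntegrable) 0
  exact (c.sub (c.comp (continuous_id.sub continuous_const))).div_const ε

/-- integration by parts in space -/
theorem space_ibp {L ε : ℝ} (hL : 0 < L) (hε : 0 < ε) {r f : ℝ → ℝ} (hr : Integrable r)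
    (hf : Integrable f) {b b' : ℝ → ℝ} {K : ℝ} (hb : ∀ z, HasDerivAt b (b' z) z)
    (hK : ∀ z, |b' z| ≤ K)
    (hv : ∀ x ∉ Ioo 0 L, ∫ y in (0:ℝ)..x, f y = 0) :
    ∫ x, b' ((∫ y in (x-ε)..x, r y) / ε) * ((∫ y in (0:ℝ)..(x-ε), f y) * ((r x - r (x-ε)) / ε))
      = - ∫ y in Ioo 0 L, b ((∫ z in y..(y+ε), r z) / ε) * f y := by
  set v : ℝ → ℝ := fun x => ∫ y in (0:ℝ)..x, f y with hvdef
  set k : ℝ → ℝ := fun y => (r (y+ε) - r y) / ε with hk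
  have hki : Integrable k := ((hr.comp_add_right ε).sub hr).div_const ε
  set c : ℝ := (∫ z in (0:ℝ)..ε, r z) / ε with hc
  have hP : ∀ y, (∫ z in y..(y+ε), r z) / ε = c + ∫ s in (0:ℝ)..y, k s := by
    intro y
    have e : ∫ s in (0:ℝ)..y, k s = ((∫ s in ε..(y+ε), r s) - ∫ s in (0:ℝ)..y, r s) / ε := by
      simp only [hk]
      rw [intervalIntegral.integral_div, intervalIntegral.integral_sub
        (hr.comp_add_right ε).intervalIntegrable hr.intervalIntegrable,
        intervalIntegral.integral_comp_add_right]
      simp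
    rw [e, hc, ← add_div]
    congr 1
    have i : ∀ a b, IntervalIntegrable r volume a b := fun a b => hr.intervalIntegrable
    have e1 := intervalIntegral.integral_add_adjacent_intervals (i 0 ε) (i ε (y+ε))
    have e2 := intervalIntegral.integral_add_adjacent_intervals (i 0 y) (i y (y+ε))
    linarith
  have step1 : ∫ x, b' ((∫ y in (x-ε)..x, r y) / ε) * (v (x-ε) * ((r x - r (x-ε)) / ε))
      = ∫ y, b' (c + ∫ s in (0:ℝ)..y, k s) * (v y * k y) := by
    rw [← integral_sub_right_eq_self (fun y => b' (c + ∫ s in (0:ℝ)..y, k s) * (v y * k y)) ε]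
    congr 1
    funext x
    rw [← hP (x - ε)]
    simp [hk]
  have step2 : ∫ y, b' (c + ∫ s in (0:ℝ)..y, k s) * (v y * k y)
      = ∫ y in (0:ℝ)..L, b' (c + ∫ s in (0:ℝ)..y, k s) * (v y * k y) := by
    rw [intervalIntegral.integral_of_le hL.le, integral_Ioc_eq_integral_Ioo,
      setIntegral_eq_integral_of_forall_compl_eq_zero]
    intro y hy
    have : v y = 0 := hv y hy
    simp [this]
  have hacP : AbsolutelyContinuousOnInterval (fun y => b (c + ∫ s in (0:ℝ)..y, k s)) 0 L := by
    have h1 := (hki.intervalIntegrable (a := 0) (b := L)).absolutelyContinuousOnInterval_intervalIntegral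
      (c := 0) (by simp)
    have h2 : AbsolutelyContinuousOnInterval (fun _ : ℝ => c) 0 L := by
      unfold AbsolutelyContinuousOnInterval; simpa using tendsto_const_nhds
    exact ac_comp (h2.add h1) (lip_of_deriv hb hK)
  have hacv : AbsolutelyContinuousOnInterval v 0 L :=
    (hf.intervalIntegrable (a := 0) (b := L)).absolutelyContinuousOnInterval_intervalIntegral
      (c := 0) (by simp)
  have ibp := hacv.integral_mul_deriv_eq_deriv_mul hacP
  have v0 : v 0 = 0 := by simp [hvdef]
  have vL : v L = 0 := hv L (by simp)
  rw [v0, vL] at ibp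
  have e1 : ∫ x in (0:ℝ)..L, v x * deriv (fun y => b (c + ∫ s in (0:ℝ)..y, k s)) x
      = ∫ y in (0:ℝ)..L, b' (c + ∫ s in (0:ℝ)..y, k s) * (v y * k y) := by
    apply intervalIntegral.integral_congr_ae
    filter_upwards [_root_.LocallyIntegrable.ae_hasDerivAt_integral hki.locallyIntegrable]
      with x hx _
    have : deriv (fun y => b (c + ∫ s in (0:ℝ)..y, k s)) x = b' (c + ∫ s in (0:ℝ)..x, k s) * k x :=
      ((hb _).comp x ((hx 0).const_add c)).deriv
    rw [this]; ring
  have e2 : ∫ x in (0:ℝ)..L, deriv v x * b (c + ∫ s in (0:ℝ)..x, k s)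
      = ∫ y in Ioo 0 L, b ((∫ z in y..(y+ε), r z) / ε) * f y := by
    rw [← integral_Ioc_eq_integral_Ioo, ← intervalIntegral.integral_of_le hL.le]
    apply intervalIntegral.integral_congr_ae
    filter_upwards [_root_.LocallyIntegrable.ae_hasDerivAt_integral hf.locallyIntegrable]
      with x hx _
    rw [(hx 0).deriv, hP, mul_comm]
  rw [step1, step2, ← e1, ibp, e2]
  ring

end CE

namespace CE
open Filter Topology Set

/-- the fixed-time commutator statement -/
theorem space_main {L : ℝ} (hL : 0 < L) {r u ux : ℝ → ℝ} (hr : Measurable r)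
    (hr0 : ∀ x ∉ Ioo 0 L, r x = 0) (hr2 : Integrable (fun x => r x ^ 2))
    (hu : ∀ x, HasDerivAt u (ux x) x) (h0 : u 0 = 0) (h1 : u L = 0)
    (hu2 : IntegrableOn (fun x => u x ^ 2 + ux x ^ 2) (Ioo 0 L))
    {b b' : ℝ → ℝ} {K : ℝ} (hb : ∀ z, HasDerivAt b (b' z) z) (hb'c : Continuous b')
    (hK : ∀ z, |b' z| ≤ K) (hK' : ∀ z, |b z| ≤ K) :
    (∀ ε > 0, |∫ x, b' ((∫ y in (x-ε)..x, r y) / ε) * ((r x * u x - r (x-ε) * u (x-ε)) / ε)|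
      ≤ K * ((∫ x, r x ^ 2) + (2 * ∫ x in Ioo 0 L, (u x ^ 2 + ux x ^ 2)) + L)) ∧
    Tendsto (fun n : ℕ => ∫ x, b' ((∫ y in (x-1/((n:ℝ)+1))..x, r y) / (1/((n:ℝ)+1))) *
      ((r x * u x - r (x-1/((n:ℝ)+1)) * u (x-1/((n:ℝ)+1))) / (1/((n:ℝ)+1)))) atTop
      (𝓝 (∫ x in Ioo 0 L, (b' (r x) * r x - b (r x)) * ux x)) := by
  have hK0 : 0 ≤ K := (abs_nonneg _).trans (hK 0)
  have bc : Continuous b := continuous_iff_continuousAt.2 fun z => (hb z).continuousAt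
  have fin : IsFiniteMeasure (volume.restrict (Ioo 0 L)) := ⟨by simp⟩
  have huxm : Measurable ux := by
    have : ux = deriv u := funext fun x => (hu x).deriv.symm
    rw [this]; exact measurable_deriv u
  have hux2 : IntegrableOn (fun x => ux x ^ 2) (Ioo 0 L) := by
    refine hu2.mono' (huxm.pow_const 2).aestronglyMeasurable (ae_of_all _ fun x => ?_)
    rw [Real.norm_eq_abs, abs_of_nonneg (sq_nonneg _)]
    nlinarith [sq_nonneg (u x)]
  have hux1 : IntegrableOn ux (Ioo 0 L) := by
    refine (hux2.add (integrable_const 1)).mono' huxm.aestronglyMeasurable (ae_of_all _ fun x => ?_)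
    simp only [Real.norm_eq_abs, Pi.add_apply]
    nlinarith [sq_nonneg (|ux x| - 1), sq_abs (ux x), abs_nonneg (ux x)]
  have hr1 : Integrable r := by
    rw [← integrableOn_iff_integrable_of_support_subset (s := Ioo 0 L)
      (fun x hx => by by_contra h; exact hx (hr0 x h))]
    refine (hr2.integrableOn.add (integrable_const 1)).mono' hr.aestronglyMeasurable
      (ae_of_all _ fun x => ?_)
    simp only [Real.norm_eq_abs, Pi.add_apply]
    nlinarith [sq_nonneg (|r x| - 1), sq_abs (r x), abs_nonneg (r x)]
  set f : ℝ → ℝ := indicator (Ioo 0 L) ux with hfdef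
  have hf : Integrable f := by rwa [hfdef, integrable_indicator_iff measurableSet_Ioo]
  have hfsq : (fun x => f x ^ 2) = indicator (Ioo 0 L) (fun x => ux x ^ 2) := by
    funext x
    by_cases hx : x ∈ Ioo 0 L <;> simp [hfdef, hx]
  have hf2 : Integrable (fun x => f x ^ 2) := by
    rwa [hfsq, integrable_indicator_iff measurableSet_Ioo]
  have If2 : ∫ x, f x ^ 2 ≤ ∫ x in Ioo 0 L, (u x ^ 2 + ux x ^ 2) := by
    rw [hfsq, integral_indicator measurableSet_Ioo]
    exact integral_mono hux2 hu2 fun x => by simpa using sq_nonneg (u x)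
  obtain ⟨pv, pL, pz⟩ := prim_facts hL hu h0 h1 hux1
  set v : ℝ → ℝ := fun x => ∫ y in (0:ℝ)..x, f y with hvdef
  have ruv : ∀ x, r x * u x = r x * v x := by
    intro x
    by_cases hx : x ∈ Ioo 0 L
    · rw [← pv x hx]
    · rw [hr0 x hx]; simp
  have vc : Continuous v := intervalIntegral.continuous_primitive (fun _ _ => hf.intervalIntegrable) 0
  have vb : ∀ x, |v x| ≤ ∫ y, |f y| := by
    intro x
    refine (intervalIntegral.norm_integral_le_integral_norm_uIoc (f := f) (μ := volume) (a := 0) (b := x)).trans ?_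
    exact setIntegral_le_integral hf.norm (ae_of_all _ fun y => norm_nonneg _)
  -- the difference quotient
  have Dv : ∀ ε x, v x - v (x - ε) = ∫ y in (x-ε)..x, f y := by
    intro ε x
    exact intervalIntegral.integral_interval_sub_left hf.intervalIntegrable hf.intervalIntegrable
  have mb' : ∀ ε, AEStronglyMeasurable (fun x => b' ((∫ y in (x-ε)..x, r y) / ε)) volume :=
    fun ε => (hb'c.comp (avg_cont hr1 ε)).aestronglyMeasurable
  have bdd' : ∀ (ε : ℝ) {g : ℝ → ℝ}, Integrable g →
      Integrable (fun x => b' ((∫ y in (x-ε)..x, r y) / ε) * g x) := by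
    intro ε g hg
    exact hg.bdd_mul (mb' ε) (ae_of_all _ fun x => hK _)
  have F1i : ∀ ε > 0, Integrable (fun x => r x * ((∫ y in (x-ε)..x, f y) / ε)) := by
    intro ε hε
    refine (hr2.add (avg_sq_int hf hf2 hε).1).mono' (hr.aestronglyMeasurable.mul
      (avg_int hf hε).1.aestronglyMeasurable) (ae_of_all _ fun x => ?_)
    simp only [Real.norm_eq_abs, Pi.add_apply, abs_mul]
    nlinarith [sq_nonneg (|r x| - |(∫ y in (x-ε)..x, f y) / ε|), sq_abs (r x),
      sq_abs ((∫ y in (x-ε)..x, f y) / ε), sq_nonneg (r x), sq_nonneg ((∫ y in (x-ε)..x, f y) / ε)]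
  have split : ∀ ε > 0,
      ∫ x, b' ((∫ y in (x-ε)..x, r y) / ε) * ((r x * u x - r (x-ε) * u (x-ε)) / ε)
      = (∫ x, b' ((∫ y in (x-ε)..x, r y) / ε) * (r x * ((∫ y in (x-ε)..x, f y) / ε)))
        - ∫ y in Ioo 0 L, b ((∫ z in y..(y+ε), r z) / ε) * f y := by
    intro ε hε
    rw [sub_eq_add_neg, ← space_ibp hL hε hr1 hf hb hK pz, ← integral_add]
    · congr 1
      funext x
      rw [ruv, ruv, ← Dv]
      simp only [hvdef]
      field_simp
      ring
    · exact bdd' ε (F1i ε hε)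
    · apply bdd' ε
      have i1 : Integrable (fun x => (r x - r (x-ε)) / ε) :=
        (hr1.sub (hr1.comp_sub_right ε)).div_const ε
      exact i1.bdd_mul (vc.comp (continuous_id.sub continuous_const)).aestronglyMeasurable
        (ae_of_all _ fun x => vb _)
  have absb : ∀ ε > 0, ∀ x, |b' ((∫ y in (x-ε)..x, r y) / ε) * (r x * ((∫ y in (x-ε)..x, f y) / ε))|
      ≤ K * (r x ^ 2 + ((∫ y in (x-ε)..x, f y) / ε) ^ 2) := by
    intro ε hε x
    rw [abs_mul]
    refine mul_le_mul (hK _) ?_ (abs_nonneg _) hK0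
    rw [abs_mul]
    nlinarith [sq_nonneg (|r x| - |(∫ y in (x-ε)..x, f y) / ε|), sq_abs (r x),
      sq_abs ((∫ y in (x-ε)..x, f y) / ε), sq_nonneg (r x), sq_nonneg ((∫ y in (x-ε)..x, f y) / ε)]
  have Gi : ∀ ε > 0, Integrable (fun x => K * (r x ^ 2 + ((∫ y in (x-ε)..x, f y) / ε) ^ 2)) :=
    fun ε hε => (hr2.add (avg_sq_int hf hf2 hε).1).const_mul K
  have GI : ∀ ε > 0, ∫ x, K * (r x ^ 2 + ((∫ y in (x-ε)..x, f y) / ε) ^ 2)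
      ≤ K * ((∫ x, r x ^ 2) + ∫ x, f x ^ 2) := by
    intro ε hε
    rw [integral_const_mul, integral_add hr2 (avg_sq_int hf hf2 hε).1]
    exact mul_le_mul_of_nonneg_left (add_le_add le_rfl (avg_sq_int hf hf2 hε).2) hK0
  constructor
  · intro ε hε
    rw [split ε hε]
    have B1 : |∫ x, b' ((∫ y in (x-ε)..x, r y) / ε) * (r x * ((∫ y in (x-ε)..x, f y) / ε))|
        ≤ K * ((∫ x, r x ^ 2) + ∫ x, f x ^ 2) :=
      ((norm_integral_le_integral_norm _).trans (integral_mono (bdd' ε (F1i ε hε)).norm (Gi ε hε)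
        (absb ε hε))).trans (GI ε hε)
    have B2 : |∫ y in Ioo 0 L, b ((∫ z in y..(y+ε), r z) / ε) * f y|
        ≤ K * ((∫ x, f x ^ 2) + L) := by
      have : ∀ᵐ y ∂(volume.restrict (Ioo 0 L)), ‖b ((∫ z in y..(y+ε), r z) / ε) * f y‖
          ≤ K * (f y ^ 2 + 1) := by
        refine ae_of_all _ fun y => ?_
        rw [Real.norm_eq_abs, abs_mul]
        refine mul_le_mul (hK' _) ?_ (abs_nonneg _) hK0
        nlinarith [sq_nonneg (|f y| - 1), sq_abs (f y), abs_nonneg (f y)]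
      refine (norm_integral_le_of_norm_le
        ((hf2.integrableOn.add (integrable_const 1)).const_mul K) this).trans ?_
      simp only [Pi.add_apply]
      rw [integral_const_mul, integral_add hf2.integrableOn (integrable_const 1)]
      refine mul_le_mul_of_nonneg_left (add_le_add
        (setIntegral_le_integral hf2 (ae_of_all _ fun y => sq_nonneg _)) ?_) hK0
      simp [hL.le]
    have := abs_sub (∫ x, b' ((∫ y in (x-ε)..x, r y) / ε) * (r x * ((∫ y in (x-ε)..x, f y) / ε)))
      (∫ y in Ioo 0 L, b ((∫ z in y..(y+ε), r z) / ε) * f y)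
    nlinarith
  · have pos : ∀ n : ℕ, (0:ℝ) < 1 / ((n : ℝ) + 1) := fun n => by positivity
    refine Tendsto.congr (fun n => (split _ (pos n)).symm) ?_
    have lim1 : Tendsto (fun n : ℕ => ∫ x, b' ((∫ y in (x-1/((n:ℝ)+1))..x, r y) / (1/((n:ℝ)+1))) *
        (r x * ((∫ y in (x-1/((n:ℝ)+1))..x, f y) / (1/((n:ℝ)+1))))) atTop
        (𝓝 (∫ x, b' (r x) * (r x * f x))) := by
      refine gdct (G := fun n x => K * (r x ^ 2 + ((∫ y in (x-1/((n:ℝ)+1))..x, f y) / (1/((n:ℝ)+1))) ^ 2))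
        (g := fun x => K * (r x ^ 2 + f x ^ 2)) (fun n => bdd' _ (F1i _ (pos n)))
        (fun n => Gi _ (pos n)) ((hr2.add hf2).const_mul K)
        (fun n => ae_of_all _ (absb _ (pos n))) ?_ ?_ (fun n => (GI _ (pos n)).trans_eq ?_)
      · filter_upwards [avg_tendsto hr1, avg_tendsto hf] with x h2 h3
        exact ((hb'c.tendsto _).comp h2.1).mul (h3.1.const_mul _)
      · filter_upwards [avg_tendsto hf] with x h3
        exact ((h3.1.pow 2).const_add _).const_mul _
      · rw [integral_const_mul, integral_add hr2 hf2]
    have lim2 : Tendsto (fun n : ℕ => ∫ y in Ioo 0 L,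
        b ((∫ z in y..(y+1/((n:ℝ)+1)), r z) / (1/((n:ℝ)+1))) * f y) atTop
        (𝓝 (∫ y in Ioo 0 L, b (r y) * f y)) := by
      refine tendsto_integral_of_dominated_convergence (fun y => K * |f y|) ?_
        (hf.norm.const_mul K).integrableOn ?_ ?_
      · intro n
        refine AEStronglyMeasurable.mul ?_ hf.aestronglyMeasurable.restrict
        have := (bc.comp (avg_cont hr1 (1/((n:ℝ)+1)))).comp (continuous_add_const (1/((n:ℝ)+1)))
        refine (this.aestronglyMeasurable).congr (ae_of_all _ fun y => ?_)
        simp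
      · intro n
        refine ae_of_all _ fun y => ?_
        rw [Real.norm_eq_abs, abs_mul]
        exact mul_le_mul_of_nonneg_right (hK' _) (abs_nonneg _)
      · filter_upwards [ae_restrict_of_ae (avg_tendsto hr1)] with x h2
        exact ((bc.tendsto _).comp h2.2).mul_const _
    have e : ∫ x in Ioo 0 L, (b' (r x) * r x - b (r x)) * ux x
        = (∫ x, b' (r x) * (r x * f x)) - ∫ y in Ioo 0 L, b (r y) * f y := by
      have e1 : ∫ x, b' (r x) * (r x * f x) = ∫ x in Ioo 0 L, b' (r x) * (r x * f x) := by
        rw [setIntegral_eq_integral_of_forall_compl_eq_zero]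
        intro x hx
        simp [hr0 x hx]
      rw [e1, ← integral_sub]
      · refine setIntegral_congr_fun measurableSet_Ioo fun x hx => ?_
        have : f x = ux x := indicator_of_mem hx ux
        simp only [this]; ring
      · have i1 : Integrable (fun x => r x * f x) := by
          refine (hr2.add hf2).mono' (hr.aestronglyMeasurable.mul hf.aestronglyMeasurable)
            (ae_of_all _ fun x => ?_)
          simp only [Real.norm_eq_abs, Pi.add_apply, abs_mul]
          nlinarith [sq_nonneg (|r x| - |f x|), sq_abs (r x), sq_abs (f x), sq_nonneg (r x),
            sq_nonneg (f x)]
        exact (i1.bdd_mul (hb'c.measurable.comp hr).aestronglyMeasurable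
          (ae_of_all _ fun x => hK _)).integrableOn
      · exact (hf.bdd_mul (bc.measurable.comp hr).aestronglyMeasurable
          (ae_of_all _ fun x => hK' _)).integrableOn
    rw [e]
    exact lim1.sub lim2

end CE

namespace CE
open Filter Topology Set

theorem prim_contDiff {ψ : ℝ → ℝ} (hψ : ContDiff ℝ (⊤ : ℕ∞) ψ) (a : ℝ) :
    ContDiff ℝ (⊤ : ℕ∞) (fun t => ∫ s in a..t, ψ s) ∧ deriv (fun t => ∫ s in a..t, ψ s) = ψ := by
  have hd : ∀ t, HasDerivAt (fun t => ∫ s in a..t, ψ s) (ψ t) t := fun t =>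
    intervalIntegral.integral_hasDerivAt_right (hψ.continuous.intervalIntegrable _ _)
      (hψ.continuous.stronglyMeasurableAtFilter _ _) hψ.continuous.continuousAt
  have hd' : deriv (fun t => ∫ s in a..t, ψ s) = ψ := funext fun t => (hd t).deriv
  refine ⟨?_, hd'⟩
  rw [contDiff_infty_iff_deriv, hd']
  exact ⟨fun t => (hd t).differentiableAt, hψ⟩

theorem time_lemma {T c : ℝ} (hT : 0 < T) {f k : ℝ → ℝ} (hf : IntegrableOn f (Ioo 0 T))
    (hk : IntegrableOn k (Ioo 0 T))
    (h : ∀ χ : ℝ → ℝ, ContDiff ℝ (⊤ : ℕ∞) χ → (∃ T' < T, ∀ t, T' ≤ t → χ t = 0) →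
      (∫ t in Ioo 0 T, (deriv χ t * f t + χ t * k t)) + c * χ 0 = 0) :
    ∀ᵐ t ∂volume.restrict (Ioo 0 T), f t = c + ∫ s in Ioo 0 t, k s := by
  have hk' : IntervalIntegrable k volume 0 T := by
    rwa [intervalIntegrable_iff_integrableOn_Ioo_of_le hT.le]
  set K : ℝ → ℝ := fun t => c + ∫ s in (0:ℝ)..t, k s with hK
  have hac : AbsolutelyContinuousOnInterval K 0 T := by
    have h1 := hk'.absolutelyContinuousOnInterval_intervalIntegral (c := 0) (by simp)
    have h2 : AbsolutelyContinuousOnInterval (fun _ : ℝ => c) 0 T := by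
      unfold AbsolutelyContinuousOnInterval; simpa using tendsto_const_nhds
    exact h2.add h1
  have hKc : ContinuousOn K (Icc 0 T) := by
    have := hac.continuousOn
    rwa [uIcc_of_le hT.le] at this
  have hKi : IntegrableOn K (Ioo 0 T) := (hKc.integrableOn_Icc).mono_set Ioo_subset_Icc_self
  have hz : ∀ᵐ t, t ∈ Ioo 0 T → f t - K t = 0 := by
    refine isOpen_Ioo.ae_eq_zero_of_integral_contDiff_smul_eq_zero
      ((hf.sub hKi).locallyIntegrableOn) ?_
    intro ψ hψ hc hs
    obtain ⟨hχ, hχd⟩ := prim_contDiff hψ T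
    set χ : ℝ → ℝ := fun t => ∫ s in T..t, ψ s with hχdef
    have hvan : ∃ T' < T, ∀ t, T' ≤ t → χ t = 0 := by
      have : ∃ T' < T, ∀ t, T' ≤ t → ψ t = 0 := by
        rcases (tsupport ψ).eq_empty_or_nonempty with he | hne
        · refine ⟨T - 1, by linarith, fun t _ => ?_⟩
          apply image_eq_zero_of_notMem_tsupport
          simp [he]
        · obtain ⟨m, hm, hm'⟩ := hc.isCompact.exists_isGreatest hne
          have := (hs hm).2
          refine ⟨(m + T)/2, by linarith, fun t ht => ?_⟩
          apply image_eq_zero_of_notMem_tsupport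
          intro hh
          have := hm' hh
          linarith
      obtain ⟨T', h1, h2⟩ := this
      refine ⟨T', h1, fun t ht => ?_⟩
      have : ∫ s in T..t, ψ s = ∫ s in T..t, (0:ℝ) := by
        apply intervalIntegral.integral_congr
        intro s hs
        have : T' ≤ s := (le_min h1.le ht).trans hs.1
        exact h2 s this
      simp [hχdef, this]
    have e := h χ hχ hvan
    obtain ⟨T', h1, h2⟩ := hvan
    have hχT : χ T = 0 := h2 T h1.le
    have acχ : AbsolutelyContinuousOnInterval χ 0 T :=
      (hψ.continuous.intervalIntegrable 0 T).absolutelyContinuousOnInterval_intervalIntegral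
        (c := T) (by simp)
    have ibp := acχ.integral_mul_deriv_eq_deriv_mul hac
    have e1 : ∫ t in (0:ℝ)..T, χ t * deriv K t = ∫ t in Ioo 0 T, χ t * k t := by
      rw [← integral_Ioc_eq_integral_Ioo, ← intervalIntegral.integral_of_le hT.le]
      apply intervalIntegral.integral_congr_ae
      filter_upwards [hk'.ae_hasDerivAt_integral] with x hx hx'
      rw [((hx (by rw [uIcc_of_le hT.le]; rw [uIoc_of_le hT.le] at hx'; exact ⟨hx'.1.le, hx'.2⟩) 0 (by simp)).const_add c).deriv]
    have e2 : ∫ t in (0:ℝ)..T, deriv χ t * K t = ∫ t in Ioo 0 T, ψ t * K t := by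
      rw [hχd, intervalIntegral.integral_of_le hT.le, integral_Ioc_eq_integral_Ioo]
    have K0 : K 0 = c := by simp [hK]
    rw [e1, e2, hχT, K0] at ibp
    have bψ : ∀ {g : ℝ → ℝ}, IntegrableOn g (Ioo 0 T) → ∀ η : ℝ → ℝ, Continuous η →
        IntegrableOn (fun t => η t * g t) (Ioo 0 T) := by
      intro g hg η hη
      obtain ⟨C, hC⟩ := isCompact_Icc.exists_bound_of_continuousOn (s := Icc 0 T) hη.continuousOn
      refine hg.bdd_mul hη.aestronglyMeasurable (c := C) ?_
      exact (ae_restrict_iff' measurableSet_Ioo).2 (ae_of_all _ fun t ht => hC t ⟨ht.1.le, ht.2.le⟩)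
    rw [hχd, integral_add (bψ hf ψ hψ.continuous) (bψ hk χ hχ.continuous)] at e
    have : ∫ x, ψ x • (f x - K x) = ∫ x in Ioo 0 T, (ψ x * f x - ψ x * K x) := by
      rw [setIntegral_eq_integral_of_forall_compl_eq_zero]
      · simp [mul_sub]
      · intro x hx
        have : ψ x = 0 := image_eq_zero_of_notMem_tsupport fun hh => hx (hs hh)
        simp [this]
    rw [this, integral_sub (bψ hf ψ hψ.continuous) (bψ hKi ψ hψ.continuous)]
    linarith
  rw [ae_restrict_iff' measurableSet_Ioo]
  filter_upwards [hz] with t ht htm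
  have := ht htm
  rw [hK] at this
  simp only at this
  rw [← integral_Ioc_eq_integral_Ioo, ← intervalIntegral.integral_of_le htm.1.le]
  linarith

end CE

namespace CE
open Filter Topology Set

/-- the hypotheses of the theorem -/
structure Sol (T L : ℝ) (ρ u ux : ℝ → ℝ → ℝ) (ρ0 : ℝ → ℝ) : Prop where
  hT : 0 < T
  hL : 0 < L
  nn : ∀ t x, 0 ≤ ρ t x
  nn0 : ∀ x, 0 ≤ ρ0 x
  meas : Measurable (fun p : ℝ × ℝ => ρ p.1 p.2)
  L2 : IntegrableOn (fun p : ℝ × ℝ => (ρ p.1 p.2) ^ 2) (Ioo 0 T ×ˢ Ioo 0 L)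
  hu : ∀ t x, HasDerivAt (u t) (ux t x) x
  uL2 : IntegrableOn (fun p : ℝ × ℝ => (u p.1 p.2) ^ 2 + (ux p.1 p.2) ^ 2) (Ioo 0 T ×ˢ Ioo 0 L)
  bc : ∀ t, u t 0 = 0 ∧ u t L = 0
  int0 : IntegrableOn ρ0 (Ioo 0 L)
  log0 : IntegrableOn (fun x => ρ0 x * Real.log (ρ0 x)) (Ioo 0 L)
  weak : ∀ φ : ℝ → ℝ → ℝ, ContDiff ℝ (⊤ : ℕ∞) (fun p : ℝ × ℝ => φ p.1 p.2) →
      (∃ T' < T, ∀ t x, T' ≤ t → φ t x = 0) →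
      (∫ t in Ioo 0 T, ∫ x in Ioo 0 L,
          ρ t x * (deriv (fun s => φ s x) t + u t x * deriv (fun y => φ t y) x))
        + (∫ x in Ioo 0 L, ρ0 x * φ 0 x) = 0

instance finL (L : ℝ) : IsFiniteMeasure (volume.restrict (Ioo 0 L)) := ⟨by simp⟩

theorem prod_restr (T L : ℝ) : (volume : Measure (ℝ × ℝ)).restrict (Ioo 0 T ×ˢ Ioo 0 L)
    = (volume.restrict (Ioo 0 T)).prod (volume.restrict (Ioo 0 L)) := by
  rw [Measure.volume_eq_prod, Measure.prod_restrict]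

/-- continuous functions are harmless multipliers -/
theorem cmul {L : ℝ} {g : ℝ → ℝ} (hg : IntegrableOn g (Ioo 0 L)) {η : ℝ → ℝ} (hη : Continuous η) :
    IntegrableOn (fun t => g t * η t) (Ioo 0 L) := by
  obtain ⟨C, hC⟩ := isCompact_Icc.exists_bound_of_continuousOn (s := Icc 0 L) hη.continuousOn
  refine hg.mul_bdd (c := C) hη.aestronglyMeasurable ?_
  exact (ae_restrict_iff' measurableSet_Ioo).2 (ae_of_all _ fun t ht => hC t ⟨ht.1.le, ht.2.le⟩)

section
variable {T L : ℝ} {ρ u ux : ℝ → ℝ → ℝ} {ρ0 : ℝ → ℝ}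

theorem Sol.S_int (h : Sol T L ρ u ux ρ0) :
    IntegrableOn (fun t => ∫ x in Ioo 0 L, ρ t x ^ 2) (Ioo 0 T) := by
  have := h.L2
  rw [IntegrableOn, prod_restr] at this
  exact this.integral_prod_left

theorem Sol.U_int (h : Sol T L ρ u ux ρ0) :
    IntegrableOn (fun t => ∫ x in Ioo 0 L, (u t x ^ 2 + ux t x ^ 2)) (Ioo 0 T) := by
  have := h.uL2
  rw [IntegrableOn, prod_restr] at this
  exact this.integral_prod_left

theorem Sol.good (h : Sol T L ρ u ux ρ0) : ∀ᵐ t ∂volume.restrict (Ioo 0 T),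
    IntegrableOn (fun x => ρ t x ^ 2) (Ioo 0 L) ∧
    IntegrableOn (fun x => u t x ^ 2 + ux t x ^ 2) (Ioo 0 L) := by
  have h1 := h.L2
  have h2 := h.uL2
  rw [IntegrableOn, prod_restr] at h1 h2
  filter_upwards [h1.prod_right_ae, h2.prod_right_ae] with t a b using ⟨a, b⟩

theorem Sol.measx (h : Sol T L ρ u ux ρ0) (t : ℝ) : Measurable (ρ t) :=
  h.meas.comp (measurable_const.prodMk measurable_id)

theorem Sol.ucont (h : Sol T L ρ u ux ρ0) (t : ℝ) : Continuous (u t) :=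
  continuous_iff_continuousAt.2 fun x => (h.hu t x).continuousAt

theorem Sol.uxmeas (h : Sol T L ρ u ux ρ0) (t : ℝ) : Measurable (ux t) := by
  have : ux t = deriv (u t) := funext fun x => (h.hu t x).deriv.symm
  rw [this]; exact measurable_deriv _

theorem Sol.rint (h : Sol T L ρ u ux ρ0) {t : ℝ}
    (ht : IntegrableOn (fun x => ρ t x ^ 2) (Ioo 0 L)) : IntegrableOn (ρ t) (Ioo 0 L) := by
  refine (ht.add (integrable_const 1)).mono' (h.measx t).aestronglyMeasurable
    (ae_of_all _ fun x => ?_)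
  rw [Real.norm_eq_abs, abs_of_nonneg (h.nn t x)]
  simp only [Pi.add_apply]
  nlinarith [sq_nonneg (ρ t x - 1), h.nn t x]

theorem Sol.rint2 (h : Sol T L ρ u ux ρ0) :
    Integrable (fun p : ℝ × ℝ => ρ p.1 p.2)
      ((volume.restrict (Ioo 0 T)).prod (volume.restrict (Ioo 0 L))) := by
  have h1 := h.L2
  rw [IntegrableOn, prod_restr] at h1
  refine (h1.add (integrable_const 1)).mono' h.meas.aestronglyMeasurable
    (ae_of_all _ fun x => ?_)
  rw [Real.norm_eq_abs, abs_of_nonneg (h.nn _ _)]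
  simp only [Pi.add_apply]
  nlinarith [sq_nonneg (ρ x.1 x.2 - 1), h.nn x.1 x.2]

theorem Sol.F_int (h : Sol T L ρ u ux ρ0) {g : ℝ → ℝ} (hg : Continuous g) :
    IntegrableOn (fun t => ∫ x in Ioo 0 L, ρ t x * g x) (Ioo 0 T) := by
  obtain ⟨C, hC⟩ := isCompact_Icc.exists_bound_of_continuousOn (s := Icc 0 L) hg.continuousOn
  have : Integrable (fun p : ℝ × ℝ => ρ p.1 p.2 * g p.2)
      ((volume.restrict (Ioo 0 T)).prod (volume.restrict (Ioo 0 L))) := by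
    refine h.rint2.mul_bdd (c := C) (hg.comp continuous_snd).aestronglyMeasurable ?_
    rw [← prod_restr, ae_restrict_iff' (measurableSet_Ioo.prod measurableSet_Ioo)]
    exact ae_of_all _ fun p hp => hC p.2 ⟨hp.2.1.le, hp.2.2.le⟩
  exact this.integral_prod_left

theorem Sol.weak' (h : Sol T L ρ u ux ρ0) {g : ℝ → ℝ} (hg : ContDiff ℝ (⊤ : ℕ∞) g)
    {χ χ1 : ℝ → ℝ} (hχ : ContDiff ℝ (⊤ : ℕ∞) χ) (hχ1 : ContDiff ℝ (⊤ : ℕ∞) χ1)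
    (hv : ∃ T' < T, ∀ t, T' ≤ t → χ t = 0) (hv1 : ∃ T' < T, ∀ t, T' ≤ t → χ1 t = 0) :
    (∫ t in Ioo 0 T, ((deriv χ t * (∫ x in Ioo 0 L, ρ t x * g x)
      + χ t * ∫ x in Ioo 0 L, ρ t x * (u t x * deriv g x))
      + deriv χ1 t * ∫ x in Ioo 0 L, ρ t x))
      + (χ 0 * (∫ x in Ioo 0 L, ρ0 x * g x) + χ1 0 * ∫ x in Ioo 0 L, ρ0 x) = 0 := by
  have hw := h.weak (fun t x => χ t * g x + χ1 t)
    (((hχ.comp contDiff_fst).mul (hg.comp contDiff_snd)).add (hχ1.comp contDiff_fst)) (by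
      obtain ⟨a, ha, ha'⟩ := hv
      obtain ⟨b, hb, hb'⟩ := hv1
      refine ⟨max a b, max_lt ha hb, fun t x ht => ?_⟩
      rw [ha' t (le_trans (le_max_left _ _) ht), hb' t (le_trans (le_max_right _ _) ht)]
      simp)
  refine Eq.trans ?_ hw
  congr 1
  · apply integral_congr_ae
    filter_upwards [h.good] with t ht
    have r1 := h.rint ht.1
    have e : ∀ x, ρ t x * (deriv (fun s => χ s * g x + χ1 s) t + u t x * deriv (fun y => χ t * g y + χ1 t) x)
      = deriv χ t * (ρ t x * g x) + χ t * (ρ t x * (u t x * deriv g x)) + deriv χ1 t * ρ t x := by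
      intro x
      have d1 : deriv (fun s => χ s * g x + χ1 s) t = deriv χ t * g x + deriv χ1 t := by
        have a := (hχ.differentiable (by simp) t).hasDerivAt
        have b := (hχ1.differentiable (by simp) t).hasDerivAt
        exact ((a.mul_const (g x)).add b).deriv
      have d2 : deriv (fun y => χ t * g y + χ1 t) x = χ t * deriv g x := by
        have a := (hg.differentiable (by simp) x).hasDerivAt
        exact ((a.const_mul (χ t)).add_const (χ1 t)).deriv
      rw [d1, d2]; ring
    simp_rw [e]
    have i1 := cmul r1 hg.continuous
    have i2 : IntegrableOn (fun x => ρ t x * (u t x * deriv g x)) (Ioo 0 L) :=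
      cmul r1 ((h.ucont t).mul (hg.continuous_deriv (by simp)))
    have i3 : IntegrableOn (fun x => deriv χ t * (ρ t x * g x) + χ t * (ρ t x * (u t x * deriv g x)))
        (Ioo 0 L) := (i1.const_mul _).add (i2.const_mul _)
    rw [integral_add i3 (r1.const_mul _),
      integral_add (i1.const_mul _) (i2.const_mul _), integral_const_mul, integral_const_mul,
      integral_const_mul]
  · rw [← integral_const_mul, ← integral_const_mul, ← integral_add
      ((cmul h.int0 hg.continuous).const_mul _) (h.int0.const_mul _)]
    congr 1
    funext x
    ring

/-- cutoff functions -/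
theorem cutoff {T : ℝ} (n : ℕ) :
    ContDiff ℝ (⊤ : ℕ∞) (fun t => Real.smoothTransition (((n:ℝ)+1) * (T - t) - 1)) ∧
    ∃ T' < T, ∀ t, T' ≤ t → Real.smoothTransition (((n:ℝ)+1) * (T - t) - 1) = 0 := by
  constructor
  · exact Real.smoothTransition.contDiff.comp
      ((contDiff_const.mul (contDiff_const.sub contDiff_id)).sub contDiff_const)
  · refine ⟨T - 1/((n:ℝ)+1), by have : 0 < 1/((n:ℝ)+1) := by positivity
                                linarith, fun t ht => ?_⟩
    apply Real.smoothTransition.zero_of_nonpos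
    have : T - t ≤ 1/((n:ℝ)+1) := by linarith
    rw [le_div_iff₀ (by positivity)] at this
    linarith

theorem cutoff_lim {T t : ℝ} (ht : t < T) :
    ∀ᶠ n : ℕ in atTop, Real.smoothTransition (((n:ℝ)+1) * (T - t) - 1) = 1 := by
  obtain ⟨N, hN⟩ := exists_nat_gt (2 / (T - t))
  filter_upwards [eventually_ge_atTop N] with n hn
  apply Real.smoothTransition.one_of_one_le
  have : 0 < T - t := by linarith
  rw [div_lt_iff₀ this] at hN
  have : (N:ℝ) ≤ n := by exact_mod_cast hn
  nlinarith

theorem Sol.degenerate (h : Sol T L ρ u ux ρ0) (h0 : ∫ x in Ioo 0 L, ρ0 x = 0) :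
    (∀ᵐ x ∂volume.restrict (Ioo 0 L), ρ0 x = 0) ∧
    ∀ᵐ t ∂volume.restrict (Ioo 0 T), ∀ᵐ x ∂volume.restrict (Ioo 0 L), ρ t x = 0 := by
  constructor
  · exact (integral_eq_zero_iff_of_nonneg (fun x => h.nn0 x) h.int0).1 h0
  · have hF := h.F_int (g := fun _ => 1) continuous_const
    simp only [mul_one] at hF
    have := time_lemma (c := 0) h.hT hF (integrable_zero _ _ _) (by
      intro χ hχ hv
      have := h.weak' (g := fun _ => 1) contDiff_const (χ := fun _ => 0) contDiff_const hχ
        ⟨T - 1, by linarith, by simp⟩ hv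
      simpa [h0] using this)
    filter_upwards [this, h.good] with t ht hg
    have ht' : ∫ x in Ioo 0 L, ρ t x = 0 := by simpa using ht
    exact (integral_eq_zero_iff_of_nonneg (fun x => h.nn t x) (h.rint hg.1)).1 ht'

theorem Sol.moment (h : Sol T L ρ u ux ρ0) (h0 : ∫ x in Ioo 0 L, ρ0 x ≠ 0)
    {g : ℝ → ℝ} (hg : ContDiff ℝ (⊤ : ℕ∞) g) :
    IntegrableOn (fun t => ∫ x in Ioo 0 L, ρ t x * (u t x * deriv g x)) (Ioo 0 T) ∧
    ∀ᵐ t ∂volume.restrict (Ioo 0 T), ∫ x in Ioo 0 L, ρ t x * g x =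
      (∫ x in Ioo 0 L, ρ0 x * g x)
        + ∫ s in Ioo 0 t, ∫ x in Ioo 0 L, ρ s x * (u s x * deriv g x) := by
  have hF := h.F_int hg.continuous
  have hF1 := h.F_int (g := fun _ => 1) continuous_const
  simp only [mul_one] at hF1
  set F := fun t => ∫ x in Ioo 0 L, ρ t x * g x with hFd
  set k := fun t => ∫ x in Ioo 0 L, ρ t x * (u t x * deriv g x) with hk
  have cm : ∀ {f : ℝ → ℝ}, IntegrableOn f (Ioo 0 T) → ∀ {χ : ℝ → ℝ}, Continuous χ →
      IntegrableOn (fun t => χ t * f t) (Ioo 0 T) := by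
    intro f hf χ hχ
    simpa only [mul_comm] using cmul hf hχ
  have A_int : ∀ χ : ℝ → ℝ, ContDiff ℝ (⊤ : ℕ∞) χ → (∃ T' < T, ∀ t, T' ≤ t → χ t = 0) →
      IntegrableOn (fun t => deriv χ t * F t + χ t * k t) (Ioo 0 T) := by
    intro χ hχ hv
    by_contra hn
    have hz : ContDiff ℝ (⊤ : ℕ∞) (fun _ : ℝ => (0:ℝ)) := contDiff_const
    have w1 := h.weak' hg hχ hz hv ⟨T - 1, by linarith, by simp⟩
    simp only [deriv_const, zero_mul, add_zero] at w1
    rw [integral_undef hn, zero_add] at w1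
    obtain ⟨c1, c2⟩ := cutoff (T := T) 0
    obtain ⟨n, hn1⟩ := (cutoff_lim (T := T) (t := 0) h.hT).exists
    obtain ⟨c1, c2⟩ := cutoff (T := T) n
    set χ1 := fun t => Real.smoothTransition (((n:ℝ)+1) * (T - t) - 1) with hχ1
    have w2 := h.weak' hg hχ c1 hv c2
    rw [integral_undef] at w2
    · have : χ1 0 = 1 := hn1
      rw [w1, this, one_mul, zero_add, zero_add] at w2
      exact h0 w2
    · intro hi
      apply hn
      have := Integrable.sub hi (cm hF1 (c1.continuous_deriv (by simp)))
      refine this.congr (ae_of_all _ fun t => ?_)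
      simp [hFd, hk]
  have χk : ∀ χ : ℝ → ℝ, ContDiff ℝ (⊤ : ℕ∞) χ → (∃ T' < T, ∀ t, T' ≤ t → χ t = 0) →
      IntegrableOn (fun t => χ t * k t) (Ioo 0 T) := by
    intro χ hχ hv
    refine (Integrable.sub (A_int χ hχ hv) (cm hF (hχ.continuous_deriv (by simp)))).congr
      (ae_of_all _ fun t => ?_)
    simp
  have kmeas : AEStronglyMeasurable k (volume.restrict (Ioo 0 T)) := by
    refine aestronglyMeasurable_of_tendsto_ae (u := atTop)
      (f := fun (n : ℕ) t => Real.smoothTransition (((n:ℝ)+1) * (T - t) - 1) * k t)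
      (fun n : ℕ => (χk _ (cutoff n).1 (cutoff n).2).aestronglyMeasurable) ?_
    rw [ae_restrict_iff' measurableSet_Ioo]
    refine ae_of_all _ fun t ht => ?_
    apply tendsto_const_nhds.congr'
    filter_upwards [cutoff_lim ht.2] with n hn
    rw [hn, one_mul]
  have hgc : Continuous (deriv g) := hg.continuous_deriv (by simp)
  obtain ⟨C, hC⟩ := isCompact_Icc.exists_bound_of_continuousOn (s := Icc 0 L) hgc.continuousOn
  have kint : IntegrableOn k (Ioo 0 T) := by
    refine ((h.S_int.add h.U_int).const_mul C).mono' kmeas ?_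
    filter_upwards [h.good] with t ht
    simp only [Pi.add_apply]
    rw [← integral_add ht.1 ht.2, ← integral_const_mul]
    refine norm_integral_le_of_norm_le ((ht.1.add ht.2).const_mul C) ?_
    rw [ae_restrict_iff' measurableSet_Ioo]
    refine ae_of_all _ fun x hx => ?_
    have c := hC x ⟨hx.1.le, hx.2.le⟩
    have c0 : 0 ≤ C := (norm_nonneg _).trans c
    rw [Real.norm_eq_abs] at c ⊢
    rw [← mul_assoc, abs_mul, mul_comm C]
    refine mul_le_mul ?_ c (abs_nonneg _) (by positivity)
    rw [abs_le]
    constructor <;> nlinarith [sq_nonneg (ρ t x - u t x), sq_nonneg (ρ t x + u t x), sq_nonneg (ux t x),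
      sq_nonneg (ρ t x), sq_nonneg (u t x)]
  refine ⟨kint, ?_⟩
  refine time_lemma h.hT hF kint ?_
  intro χ hχ hv
  have hz : ContDiff ℝ (⊤ : ℕ∞) (fun _ : ℝ => (0:ℝ)) := contDiff_const
  have w1 := h.weak' hg hχ hz hv ⟨T - 1, by linarith, by simp⟩
  simp only [deriv_const, zero_mul, add_zero] at w1
  rw [mul_comm (∫ x in Ioo 0 L, ρ0 x * g x)]
  exact w1

end
end CE

namespace CE
open Filter Topology Set

theorem caratheodory {μ : Measure ℝ} {P : ℝ → ℝ → ℝ} (hm : ∀ x, AEMeasurable (fun s => P s x) μ)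
    (hc : ∀ᵐ s ∂μ, Continuous (P s)) :
    ∃ Q : ℝ × ℝ → ℝ, Measurable Q ∧ ∀ᵐ s ∂μ, ∀ x, Q (s, x) = P s x := by
  set R : ℕ → ℝ × ℤ → ℝ := fun n p => (hm ((p.2 : ℝ) / ((n:ℝ)+1))).mk _ p.1 with hR
  have Rm : ∀ n, Measurable (R n) := fun n =>
    measurable_from_prod_countable_left fun j => (hm ((j : ℝ) / ((n:ℝ)+1))).measurable_mk
  set Qn : ℕ → ℝ × ℝ → ℝ := fun n p => R n (p.1, ⌊((n:ℝ)+1) * p.2⌋) with hQn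
  have Qm : ∀ n, Measurable (Qn n) := fun n =>
    (Rm n).comp (measurable_fst.prodMk (Int.measurable_floor.comp (measurable_snd.const_mul _)))
  refine ⟨fun p => limsup (fun n => Qn n p) atTop, Measurable.limsup Qm, ?_⟩
  have hall : ∀ᵐ s ∂μ, ∀ (n : ℕ) (j : ℤ), P s ((j : ℝ) / ((n:ℝ)+1)) = R n (s, j) :=
    ae_all_iff.2 fun n => ae_all_iff.2 fun j => (hm ((j : ℝ) / ((n:ℝ)+1))).ae_eq_mk
  filter_upwards [hc, hall] with s h1 h2 x
  apply Tendsto.limsup_eq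
  simp only [hQn, ← h2]
  refine (h1.tendsto x).comp ?_
  have l1 : Tendsto (fun n : ℕ => x - 1 / ((n : ℝ) + 1)) atTop (𝓝 x) := by
    simpa using tendsto_const_nhds.sub eps_tendsto
  refine tendsto_of_tendsto_of_tendsto_of_le_of_le l1 tendsto_const_nhds (fun n => ?_) (fun n => ?_)
  · have := Int.lt_floor_add_one (((n:ℝ)+1) * x)
    have p : (0:ℝ) < (n:ℝ)+1 := by positivity
    simp only
    rw [le_div_iff₀ p, sub_mul, div_mul_cancel₀ _ p.ne']
    linarith
  · have := Int.floor_le (((n:ℝ)+1) * x)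
    have p : (0:ℝ) < (n:ℝ)+1 := by positivity
    simp only
    rw [div_le_iff₀ p]
    linarith

section
variable {T L : ℝ} {ρ u ux : ℝ → ℝ → ℝ} {ρ0 : ℝ → ℝ}

theorem Sol.wint (h : Sol T L ρ u ux ρ0) {t : ℝ}
    (ht : IntegrableOn (fun x => ρ t x ^ 2) (Ioo 0 L)) :
    Integrable (fun x => indicator (Ioo 0 L) (ρ t) x * u t x) := by
  have : (fun x => indicator (Ioo 0 L) (ρ t) x * u t x)
      = indicator (Ioo 0 L) (fun x => ρ t x * u t x) := by
    funext x
    by_cases hx : x ∈ Ioo 0 L <;> simp [hx]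
  rw [this, integrable_indicator_iff measurableSet_Ioo]
  exact cmul (h.rint ht) (h.ucont t)

theorem Sol.w_exists (h : Sol T L ρ u ux ρ0) (h0 : ∫ x in Ioo 0 L, ρ0 x ≠ 0) :
    ∃ w : ℝ × ℝ → ℝ, Measurable w ∧ (∀ s, ∀ x ∉ Ioo 0 L, w (s, x) = 0) ∧
      (∀ᵐ s ∂volume.restrict (Ioo 0 T), ∀ᵐ x, w (s, x) = indicator (Ioo 0 L) (ρ s) x * u s x) ∧
      Integrable w ((volume.restrict (Ioo 0 T)).prod volume) := by
  set P : ℝ → ℝ → ℝ := fun s x => ∫ y in Iio x, indicator (Ioo 0 L) (ρ s) y * u s y with hP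
  have Pm : ∀ x, AEMeasurable (fun s => P s x) (volume.restrict (Ioo 0 T)) := by
    intro x
    set hn : ℕ → ℝ → ℝ := fun n y => Real.smoothTransition ((n:ℝ) * (x - y)) with hhn
    have hns : ∀ n, ContDiff ℝ (⊤ : ℕ∞) (hn n) := fun n => Real.smoothTransition.contDiff.comp
      (contDiff_const.mul (contDiff_const.sub contDiff_id))
    refine aemeasurable_of_tendsto_metrizable_ae atTop
      (f := fun (n:ℕ) s => ∫ y in Ioo 0 L, ρ s y * (u s y * hn n y)) (fun n => ?_) ?_
    · obtain ⟨g1, g2⟩ := prim_contDiff (hns n) 0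
      have := (h.moment h0 g1).1.aestronglyMeasurable.aemeasurable
      rwa [g2] at this
    · filter_upwards [h.good] with s hs
      have hw := h.wint hs.1
      have e : ∀ n, ∫ y in Ioo 0 L, ρ s y * (u s y * hn n y)
          = ∫ y, indicator (Ioo 0 L) (ρ s) y * u s y * hn n y := by
        intro n
        rw [← integral_indicator measurableSet_Ioo]
        congr 1
        funext y
        by_cases hy : y ∈ Ioo 0 L <;> simp [hy]; ring
      simp_rw [e]
      simp only [hP]
      rw [← integral_indicator measurableSet_Iio]
      refine tendsto_integral_of_dominated_convergence _ (fun n => ?_) hw.norm (fun n => ?_) ?_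
      · exact hw.aestronglyMeasurable.mul (hns n).continuous.aestronglyMeasurable
      · refine ae_of_all _ fun y => ?_
        rw [norm_mul]
        apply mul_le_of_le_one_right (norm_nonneg _)
        rw [Real.norm_eq_abs, abs_of_nonneg (Real.smoothTransition.nonneg _)]
        exact Real.smoothTransition.le_one _
      · refine ae_of_all _ fun y => ?_
        by_cases hy : y < x
        · rw [indicator_of_mem (show y ∈ Iio x from hy)]
          apply tendsto_const_nhds.congr'
          obtain ⟨N, hN⟩ := exists_nat_gt (1 / (x - y))
          filter_upwards [eventually_ge_atTop N] with n hnN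
          have : hn n y = 1 := by
            apply Real.smoothTransition.one_of_one_le
            have : 0 < x - y := by linarith
            rw [div_lt_iff₀ this] at hN
            have : (N:ℝ) ≤ n := by exact_mod_cast hnN
            nlinarith
          rw [this, mul_one]
        · rw [indicator_of_notMem (show y ∉ Iio x from hy)]
          apply tendsto_const_nhds.congr
          intro n
          have : hn n y = 0 := by
            apply Real.smoothTransition.zero_of_nonpos
            have : x - y ≤ 0 := by linarith
            exact mul_nonpos_of_nonneg_of_nonpos (by positivity) this
          rw [this, mul_zero]
  have Pc : ∀ᵐ s ∂volume.restrict (Ioo 0 T), Continuous (P s) := by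
    filter_upwards [h.good] with s hs
    have hw := h.wint hs.1
    have : ∀ x, P s x = P s 0 + ∫ y in (0:ℝ)..x, indicator (Ioo 0 L) (ρ s) y * u s y := by
      intro x
      simp only [hP]
      rw [← integral_Iic_eq_integral_Iio, ← integral_Iic_eq_integral_Iio,
        ← intervalIntegral.integral_Iic_sub_Iic hw.integrableOn hw.integrableOn]
      ring
    have e : P s = fun x => P s 0 + ∫ y in (0:ℝ)..x, indicator (Ioo 0 L) (ρ s) y * u s y := funext this
    rw [e]
    exact continuous_const.add
      (intervalIntegral.continuous_primitive (fun _ _ => hw.intervalIntegrable) 0)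
  obtain ⟨Q, Qm, hQ⟩ := caratheodory Pm Pc
  set v : ℕ → ℝ × ℝ → ℝ := fun n p =>
    (Q p - Q (p.1, p.2 - 1 / ((n:ℝ)+1))) / (1 / ((n:ℝ)+1)) with hv
  have vm : ∀ n, Measurable (v n) := fun n =>
    (Qm.sub (Qm.comp (measurable_fst.prodMk (measurable_snd.sub_const _)))).div_const _
  set w : ℝ × ℝ → ℝ := indicator (univ ×ˢ Ioo 0 L) (fun p => limsup (fun n => v n p) atTop) with hw
  have wm : Measurable w := (Measurable.limsup vm).indicator (MeasurableSet.univ.prod measurableSet_Ioo)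
  have w0 : ∀ s, ∀ x ∉ Ioo 0 L, w (s, x) = 0 := by
    intro s x hx
    exact indicator_of_notMem (fun hh => hx hh.2) _
  have wae : ∀ᵐ s ∂volume.restrict (Ioo 0 T), ∀ᵐ x,
      w (s, x) = indicator (Ioo 0 L) (ρ s) x * u s x := by
    filter_upwards [h.good, hQ] with s hs hq
    have hwi := h.wint hs.1
    filter_upwards [avg_tendsto hwi] with x hx
    by_cases hxm : x ∈ Ioo 0 L
    · have : w (s, x) = limsup (fun n => v n (s, x)) atTop :=
        indicator_of_mem (show (s, x) ∈ univ ×ˢ Ioo 0 L from ⟨mem_univ _, hxm⟩) _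
      rw [this]
      apply Tendsto.limsup_eq
      refine hx.1.congr fun n => ?_
      simp only [hv, hq, hP]
      rw [← integral_Iic_eq_integral_Iio, ← integral_Iic_eq_integral_Iio,
        ← intervalIntegral.integral_Iic_sub_Iic hwi.integrableOn hwi.integrableOn]
    · rw [w0 s x hxm]
      simp [hxm]
  refine ⟨w, wm, w0, wae, ?_⟩
  rw [integrable_prod_iff wm.aestronglyMeasurable]
  constructor
  · filter_upwards [h.good, wae] with s hs hws
    exact (h.wint hs.1).congr (hws.mono fun x hx => hx.symm)
  · refine (h.S_int.add h.U_int).mono' wm.aestronglyMeasurable.norm.integral_prod_right' ?_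
    filter_upwards [h.good, wae] with s hs hws
    simp only [Pi.add_apply]
    rw [← integral_add hs.1 hs.2, Real.norm_eq_abs, abs_of_nonneg (integral_nonneg fun x => norm_nonneg _)]
    rw [integral_congr_ae (hws.mono fun x hx => congrArg norm hx)]
    rw [← setIntegral_eq_integral_of_forall_compl_eq_zero (s := Ioo 0 L)]
    · refine setIntegral_mono_on (h.wint hs.1).norm.integrableOn (hs.1.add hs.2) measurableSet_Ioo ?_
      intro x hx
      rw [indicator_of_mem hx, Real.norm_eq_abs, abs_le]
      constructor <;> nlinarith [sq_nonneg (ρ s x - u s x), sq_nonneg (ρ s x + u s x), sq_nonneg (ux s x),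
        sq_nonneg (ρ s x), sq_nonneg (u s x)]
    · intro x hx
      simp [hx]

end
end CE

namespace CE
open Filter Topology Set

theorem poly_zero {L : ℝ} {f : ℝ → ℝ} (hf : IntegrableOn f (Ioo 0 L))
    (h : ∀ k : ℕ, ∫ x in Ioo 0 L, f x * x ^ k = 0) :
    ∀ᵐ x ∂volume.restrict (Ioo 0 L), f x = 0 := by
  have hp : ∀ p : Polynomial ℝ, ∫ x in Ioo 0 L, f x * p.eval x = 0 := by
    intro p
    have e : ∀ x, f x * p.eval x = ∑ i ∈ Finset.range (p.natDegree + 1), p.coeff i * (f x * x ^ i) := by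
      intro x
      rw [Polynomial.eval_eq_sum_range, Finset.mul_sum]
      exact Finset.sum_congr rfl fun i _ => by ring
    simp_rw [e]
    rw [integral_finsetSum]
    · simp_rw [integral_const_mul, h]; simp
    · intro i _
      exact (cmul hf (continuous_pow i)).const_mul _
  rw [ae_restrict_iff' measurableSet_Ioo]
  refine isOpen_Ioo.ae_eq_zero_of_integral_contDiff_smul_eq_zero hf.locallyIntegrableOn ?_
  intro ψ hψ hc hs
  have e : ∫ x, ψ x • f x = ∫ x in Ioo 0 L, f x * ψ x := by
    rw [setIntegral_eq_integral_of_forall_compl_eq_zero]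
    · simp [mul_comm]
    · intro x hx
      have : ψ x = 0 := image_eq_zero_of_notMem_tsupport fun hh => hx (hs hh)
      simp [this]
  rw [e]
  have bound : ∀ ε > 0, |∫ x in Ioo 0 L, f x * ψ x| ≤ (∫ x in Ioo 0 L, |f x|) * ε := by
    intro ε hε
    obtain ⟨p, hpε⟩ := exists_polynomial_near_of_continuousOn 0 L ψ hψ.continuous.continuousOn ε hε
    have : ∫ x in Ioo 0 L, f x * ψ x = ∫ x in Ioo 0 L, f x * (ψ x - p.eval x) := by
      simp_rw [mul_sub]
      rw [integral_sub (cmul hf hψ.continuous) (cmul hf p.continuous), hp, sub_zero]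
    rw [this, ← integral_mul_const, ← Real.norm_eq_abs]
    refine norm_integral_le_of_norm_le (hf.abs.mul_const ε) ?_
    rw [ae_restrict_iff' measurableSet_Ioo]
    refine ae_of_all _ fun x hx => ?_
    rw [Real.norm_eq_abs, abs_mul]
    refine mul_le_mul_of_nonneg_left ?_ (abs_nonneg _)
    rw [abs_sub_comm]
    exact (hpε x ⟨hx.1.le, hx.2.le⟩).le
  have t : Tendsto (fun n : ℕ => (∫ x in Ioo 0 L, |f x|) * (1 / ((n:ℝ)+1))) atTop (𝓝 0) := by
    simpa using eps_tendsto.const_mul (∫ x in Ioo 0 L, |f x|)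
  have := ge_of_tendsto' t (fun n => bound (1/((n:ℝ)+1)) (by positivity))
  exact abs_eq_zero.1 (le_antisymm this (abs_nonneg _))

theorem Iic_eq {L : ℝ} {r : ℝ → ℝ} (hr : Integrable r) (hr0 : ∀ x ∉ Ioo 0 L, r x = 0) (x : ℝ) :
    ∫ y in Iic x, r y = ∫ y in (0:ℝ)..x, r y := by
  rw [← intervalIntegral.integral_Iic_sub_Iic hr.integrableOn hr.integrableOn,
    setIntegral_eq_zero_of_forall_eq_zero (t := Iic 0), sub_zero]
  intro y hy
  exact hr0 y fun hh => absurd hh.1 (not_lt.2 hy)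

theorem Iic_ge {L x : ℝ} {r : ℝ → ℝ} (hr0 : ∀ x ∉ Ioo 0 L, r x = 0) (hx : L ≤ x) :
    ∫ y in Iic x, r y = ∫ y in Ioo 0 L, r y := by
  rw [setIntegral_eq_integral_of_forall_compl_eq_zero, setIntegral_eq_integral_of_forall_compl_eq_zero]
  · exact fun y hy => hr0 y hy
  · intro y hy
    exact hr0 y fun hh => hy (hh.2.le.trans hx)

theorem Iic_cont {r : ℝ → ℝ} (hr : Integrable r) : Continuous fun x => ∫ y in Iic x, r y := by
  have : (fun x => ∫ y in Iic x, r y) = fun x => (∫ y in Iic 0, r y) + ∫ y in (0:ℝ)..x, r y := by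
    funext x
    rw [← intervalIntegral.integral_Iic_sub_Iic hr.integrableOn hr.integrableOn]
    ring
  rw [this]
  exact continuous_const.add (intervalIntegral.continuous_primitive (fun _ _ => hr.intervalIntegrable) 0)

theorem moment_ibp {L : ℝ} (hL : 0 < L) {r : ℝ → ℝ} (hr : Integrable r)
    (hr0 : ∀ x ∉ Ioo 0 L, r x = 0) (k : ℕ) :
    ∫ x in Ioo 0 L, r x * (x ^ (k+1) / (k+1)) =
      (∫ x in Ioo 0 L, r x) * (L ^ (k+1) / (k+1)) - ∫ x in Ioo 0 L, (∫ y in Iic x, r y) * x ^ k := by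
  have pd : ∀ x : ℝ, HasDerivAt (fun x : ℝ => x ^ (k+1) / ((k:ℝ)+1)) (x ^ k) x := by
    intro x
    have := (hasDerivAt_pow (k+1) x).div_const ((k:ℝ)+1)
    have e : ((k + 1 : ℕ) : ℝ) * x ^ (k + 1 - 1) / ((k:ℝ) + 1) = x ^ k := by
      rw [Nat.add_sub_cancel]
      push_cast
      have : (k:ℝ)+1 ≠ 0 := by positivity
      field_simp
    rwa [e] at this
  have acr := (hr.intervalIntegrable (a := 0) (b := L)).absolutelyContinuousOnInterval_intervalIntegral
    (c := 0) (by simp)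
  have acp : AbsolutelyContinuousOnInterval (fun x : ℝ => x ^ (k+1) / ((k:ℝ)+1)) 0 L := by
    have h1 := ((continuous_pow k).intervalIntegrable (μ := volume) (0:ℝ) L).absolutelyContinuousOnInterval_intervalIntegral
      (c := 0) (by simp)
    have : (fun x : ℝ => x ^ (k+1) / ((k:ℝ)+1)) = fun x => ∫ y in (0:ℝ)..x, y ^ k := by
      funext x; simp
    rwa [this]
  have ibp := acp.integral_mul_deriv_eq_deriv_mul acr
  have e1 : ∫ x in (0:ℝ)..L, (x ^ (k+1) / ((k:ℝ)+1)) * deriv (fun x => ∫ y in (0:ℝ)..x, r y) x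
      = ∫ x in Ioo 0 L, r x * (x ^ (k+1) / (k+1)) := by
    rw [← integral_Ioc_eq_integral_Ioo, ← intervalIntegral.integral_of_le hL.le]
    apply intervalIntegral.integral_congr_ae
    filter_upwards [_root_.LocallyIntegrable.ae_hasDerivAt_integral hr.locallyIntegrable] with x hx _
    rw [(hx 0).deriv, mul_comm]
  have e2 : ∫ x in (0:ℝ)..L, deriv (fun x : ℝ => x ^ (k+1) / ((k:ℝ)+1)) x * ∫ y in (0:ℝ)..x, r y
      = ∫ x in Ioo 0 L, (∫ y in Iic x, r y) * x ^ k := by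
    rw [← integral_Ioc_eq_integral_Ioo, ← intervalIntegral.integral_of_le hL.le]
    congr 1
    funext x
    rw [(pd x).deriv, Iic_eq hr hr0, mul_comm]
  rw [e1, e2] at ibp
  rw [ibp, ← Iic_ge hr0 le_rfl, Iic_eq hr hr0 L]
  simp
  ring

section
variable {T L : ℝ} {ρ u ux : ℝ → ℝ → ℝ} {ρ0 : ℝ → ℝ}

theorem ind0 {L : ℝ} (f : ℝ → ℝ) : ∀ x ∉ Ioo 0 L, indicator (Ioo 0 L) f x = 0 :=
  fun _ hx => indicator_of_notMem hx f

theorem ind_setint {L : ℝ} (f g : ℝ → ℝ) :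
    ∫ x in Ioo 0 L, indicator (Ioo 0 L) f x * g x = ∫ x in Ioo 0 L, f x * g x :=
  setIntegral_congr_fun measurableSet_Ioo fun x hx => by simp only [indicator_of_mem hx]

theorem ind_setint' {L : ℝ} (f : ℝ → ℝ) :
    ∫ x in Ioo 0 L, indicator (Ioo 0 L) f x = ∫ x in Ioo 0 L, f x :=
  setIntegral_congr_fun measurableSet_Ioo fun x hx => by simp only [indicator_of_mem hx]

theorem ind_integrable {L : ℝ} {f : ℝ → ℝ} (hf : IntegrableOn f (Ioo 0 L)) :
    Integrable (indicator (Ioo 0 L) f) := by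
  rwa [integrable_indicator_iff measurableSet_Ioo]

/-- the integrated equation -/
theorem Sol.integrated (h : Sol T L ρ u ux ρ0) (h0 : ∫ x in Ioo 0 L, ρ0 x ≠ 0)
    {w : ℝ × ℝ → ℝ} (w0 : ∀ s, ∀ x ∉ Ioo 0 L, w (s, x) = 0)
    (wae : ∀ᵐ s ∂volume.restrict (Ioo 0 T), ∀ᵐ x, w (s, x) = indicator (Ioo 0 L) (ρ s) x * u s x)
    (wi : Integrable w ((volume.restrict (Ioo 0 T)).prod volume)) :
    ∀ᵐ t ∂volume.restrict (Ioo 0 T), ∀ᵐ x,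
      ∫ y in Iic x, indicator (Ioo 0 L) (ρ t) y = (∫ y in Iic x, indicator (Ioo 0 L) ρ0 y)
        - ∫ s in Ioo 0 t, w (s, x) := by
  have r0i := ind_integrable h.int0
  have mass := (h.moment h0 (g := fun _ => 1) contDiff_const).2
  have mom := ae_all_iff.2 fun k : ℕ =>
    (h.moment h0 (g := fun x => x ^ (k+1) / ((k:ℝ)+1)) ((contDiff_id.pow _).div_const _)).2
  have tm : ∀ᵐ t ∂volume.restrict (Ioo 0 T), t ∈ Ioo 0 T := ae_restrict_mem measurableSet_Ioo
  filter_upwards [mass, mom, h.good, tm] with t h1 h2 hg ht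
  have ri := ind_integrable (h.rint hg.1)
  have mass' : ∫ x in Ioo 0 L, indicator (Ioo 0 L) (ρ t) x = ∫ x in Ioo 0 L, indicator (Ioo 0 L) ρ0 x := by
    rw [ind_setint', ind_setint']
    simpa using h1
  have sub : Ioo 0 t ⊆ Ioo 0 T := Ioo_subset_Ioo_right ht.2.le
  have wt : Integrable w ((volume.restrict (Ioo 0 t)).prod volume) :=
    wi.mono_measure (Measure.prod_mono (Measure.restrict_mono sub le_rfl) le_rfl)
  have wt' : Integrable w ((volume.restrict (Ioo 0 t)).prod (volume.restrict (Ioo 0 L))) :=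
    wt.mono_measure (Measure.prod_mono le_rfl Measure.restrict_le_self)
  have D0 : ∀ᵐ x ∂volume.restrict (Ioo 0 L), ((∫ y in Iic x, indicator (Ioo 0 L) (ρ t) y)
      - ∫ y in Iic x, indicator (Ioo 0 L) ρ0 y) + ∫ s in Ioo 0 t, w (s, x) = 0 := by
    have c1 : IntegrableOn (fun x => ∫ y in Iic x, indicator (Ioo 0 L) (ρ t) y) (Ioo 0 L) :=
      (Iic_cont ri).continuousOn.integrableOn_Icc.mono_set Ioo_subset_Icc_self
    have c2 : IntegrableOn (fun x => ∫ y in Iic x, indicator (Ioo 0 L) ρ0 y) (Ioo 0 L) :=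
      (Iic_cont r0i).continuousOn.integrableOn_Icc.mono_set Ioo_subset_Icc_self
    have c3 : IntegrableOn (fun x => ∫ s in Ioo 0 t, w (s, x)) (Ioo 0 L) := wt'.integral_prod_right
    apply poly_zero
    · exact (c1.sub c2).add c3
    · intro k
      have e := h2 k
      have kp : ∀ x : ℝ, deriv (fun x : ℝ => x ^ (k+1) / ((k:ℝ)+1)) x = x ^ k := by
        intro x
        have := (hasDerivAt_pow (k+1) x).div_const ((k:ℝ)+1)
        rw [this.deriv]
        simp only [Nat.add_sub_cancel]
        push_cast
        have : (k:ℝ)+1 ≠ 0 := by positivity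
        field_simp
      simp only [kp] at e
      rw [← ind_setint (ρ t), ← ind_setint ρ0, moment_ibp h.hL ri (ind0 _),
        moment_ibp h.hL r0i (ind0 _), mass'] at e
      have e3 : ∫ s in Ioo 0 t, ∫ x in Ioo 0 L, ρ s x * (u s x * x ^ k)
          = ∫ s in Ioo 0 t, ∫ x in Ioo 0 L, w (s, x) * x ^ k := by
        apply integral_congr_ae
        filter_upwards [ae_mono (Measure.restrict_mono sub le_rfl) wae] with s hs
        apply integral_congr_ae
        filter_upwards [ae_restrict_of_ae hs, ae_restrict_mem measurableSet_Ioo] with x hx hxm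
        rw [hx, indicator_of_mem hxm]; ring
      have wk : Integrable (fun p : ℝ × ℝ => w p * p.2 ^ k)
          ((volume.restrict (Ioo 0 t)).prod (volume.restrict (Ioo 0 L))) := by
        refine wt'.mul_bdd (c := L ^ k) (continuous_snd.pow k).aestronglyMeasurable ?_
        rw [← prod_restr, ae_restrict_iff' (measurableSet_Ioo.prod measurableSet_Ioo)]
        refine ae_of_all _ fun p hp => ?_
        rw [norm_pow, Real.norm_eq_abs, abs_of_pos hp.2.1]
        exact pow_le_pow_left₀ hp.2.1.le hp.2.2.le k
      have e4 : ∫ s in Ioo 0 t, ∫ x in Ioo 0 L, w (s, x) * x ^ k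
          = ∫ x in Ioo 0 L, (∫ s in Ioo 0 t, w (s, x)) * x ^ k := by
        rw [integral_integral_swap (f := fun s x => w (s, x) * x ^ k) wk]
        simp_rw [integral_mul_const]
      rw [e3, e4] at e
      simp_rw [add_mul, sub_mul]
      have cs : IntegrableOn (fun x => (∫ y in Iic x, indicator (Ioo 0 L) (ρ t) y) * x ^ k
        - (∫ y in Iic x, indicator (Ioo 0 L) ρ0 y) * x ^ k) (Ioo 0 L) :=
        (cmul c1 (continuous_pow k)).sub (cmul c2 (continuous_pow k))
      rw [integral_add cs (cmul c3 (continuous_pow k)),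
        integral_sub (cmul c1 (continuous_pow k)) (cmul c2 (continuous_pow k))]
      linarith
  rw [ae_restrict_iff' measurableSet_Ioo] at D0
  filter_upwards [D0] with x hx
  by_cases hxm : x ∈ Ioo 0 L
  · have := hx hxm
    linarith
  · have : ∫ s in Ioo 0 t, w (s, x) = 0 := by simp [w0 _ x hxm]
    rw [this, sub_zero]
    rcases le_or_gt L x with hh | hh
    · rw [Iic_ge (ind0 _) hh, Iic_ge (ind0 _) hh, mass']
    · have hx0 : x ≤ 0 := by
        by_contra hc
        exact hxm ⟨not_le.1 hc, hh⟩
      rw [setIntegral_eq_zero_of_forall_eq_zero, setIntegral_eq_zero_of_forall_eq_zero]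
      · intro y hy
        exact ind0 _ y fun hc => absurd hc.1 (not_lt.2 (le_trans hy hx0))
      · intro y hy
        exact ind0 _ y fun hc => absurd hc.1 (not_lt.2 (le_trans hy hx0))

end
end CE

namespace CE
open Filter Topology Set

theorem meas_Iic {f : ℝ × ℝ → ℝ} (hf : Measurable f) :
    Measurable (fun p : ℝ × ℝ => ∫ y in Iic p.2, f (p.1, y)) := by
  have e : (fun p : ℝ × ℝ => ∫ y in Iic p.2, f (p.1, y))
      = fun p : ℝ × ℝ => ∫ y, indicator {q : (ℝ × ℝ) × ℝ | q.2 ≤ q.1.2} (fun q => f (q.1.1, q.2)) (p, y) := by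
    funext p
    rw [← integral_indicator measurableSet_Iic]
    rfl
  rw [e]
  apply StronglyMeasurable.measurable
  apply StronglyMeasurable.integral_prod_right
  apply Measurable.stronglyMeasurable
  exact (hf.comp (measurable_fst.fst.prodMk measurable_snd)).indicator
    (measurableSet_le measurable_snd measurable_fst.snd)

theorem meas_Ioo {f : ℝ × ℝ → ℝ} (hf : Measurable f) :
    Measurable (fun p : ℝ × ℝ => ∫ s in Ioo 0 p.1, f (s, p.2)) := by
  have e : (fun p : ℝ × ℝ => ∫ s in Ioo 0 p.1, f (s, p.2))
      = fun p : ℝ × ℝ => ∫ s, indicator {q : (ℝ × ℝ) × ℝ | 0 < q.2 ∧ q.2 < q.1.1} (fun q => f (q.2, q.1.2)) (p, s) := by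
    funext p
    rw [← integral_indicator measurableSet_Ioo]
    rfl
  rw [e]
  apply StronglyMeasurable.measurable
  apply StronglyMeasurable.integral_prod_right
  apply Measurable.stronglyMeasurable
  refine (hf.comp (measurable_snd.prodMk measurable_fst.snd)).indicator ?_
  exact (measurableSet_lt measurable_const measurable_snd).inter
    (measurableSet_lt measurable_snd measurable_fst.fst)

section
variable {T L : ℝ} {ρ u ux : ℝ → ℝ → ℝ} {ρ0 : ℝ → ℝ}

theorem Sol.rmeas (h : Sol T L ρ u ux ρ0) :
    Measurable (fun p : ℝ × ℝ => indicator (Ioo 0 L) (ρ p.1) p.2) := by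
  have : (fun p : ℝ × ℝ => indicator (Ioo 0 L) (ρ p.1) p.2)
      = indicator (univ ×ˢ Ioo 0 L) (fun p : ℝ × ℝ => ρ p.1 p.2) := by
    funext p
    by_cases hp : p.2 ∈ Ioo 0 L <;> simp [indicator, hp]
  rw [this]
  exact h.meas.indicator (MeasurableSet.univ.prod measurableSet_Ioo)

theorem avg_Iic {r : ℝ → ℝ} (hr : Integrable r) (a b : ℝ) :
    (∫ y in Iic b, r y) - ∫ y in Iic a, r y = ∫ y in a..b, r y :=
  intervalIntegral.integral_Iic_sub_Iic hr.integrableOn hr.integrableOn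

theorem int_b_avg {r : ℝ → ℝ} (hr : Integrable r) {ε : ℝ} (hε : 0 < ε) {b b' : ℝ → ℝ} {K : ℝ}
    (hb : ∀ z, HasDerivAt b (b' z) z) (hK : ∀ z, |b' z| ≤ K) (b0 : b 0 = 0) :
    Integrable (fun x => b ((∫ y in (x-ε)..x, r y) / ε)) := by
  have bc : Continuous b := continuous_iff_continuousAt.2 fun z => (hb z).continuousAt
  refine ((avg_int hr hε).1.abs.const_mul K).mono'
    (bc.comp (avg_cont hr ε)).aestronglyMeasurable (ae_of_all _ fun x => ?_)
  have := lip_of_deriv hb hK ((∫ y in (x-ε)..x, r y) / ε) 0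
  simpa [b0] using this

theorem Sol.renorm_eps (h : Sol T L ρ u ux ρ0) (h0 : ∫ x in Ioo 0 L, ρ0 x ≠ 0)
    {b b' : ℝ → ℝ} {K : ℝ} (hb : ∀ z, HasDerivAt b (b' z) z) (hb'c : Continuous b')
    (hK : ∀ z, |b' z| ≤ K) (b0 : b 0 = 0) {ε : ℝ} (hε : 0 < ε) :
    AEStronglyMeasurable (fun s => ∫ x, b' ((∫ y in (x-ε)..x, indicator (Ioo 0 L) (ρ s) y) / ε) *
      ((indicator (Ioo 0 L) (ρ s) x * u s x
        - indicator (Ioo 0 L) (ρ s) (x-ε) * u s (x-ε)) / ε)) (volume.restrict (Ioo 0 T)) ∧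
    ∀ᵐ t ∂volume.restrict (Ioo 0 T),
      ∫ x, b ((∫ y in (x-ε)..x, indicator (Ioo 0 L) (ρ t) y) / ε)
      = (∫ x, b ((∫ y in (x-ε)..x, indicator (Ioo 0 L) ρ0 y) / ε))
        - ∫ s in Ioo 0 t, ∫ x, b' ((∫ y in (x-ε)..x, indicator (Ioo 0 L) (ρ s) y) / ε) *
      ((indicator (Ioo 0 L) (ρ s) x * u s x
        - indicator (Ioo 0 L) (ρ s) (x-ε) * u s (x-ε)) / ε) := by
  have bc : Continuous b := continuous_iff_continuousAt.2 fun z => (hb z).continuousAt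
  obtain ⟨w, wm, w0, wae, wi⟩ := h.w_exists h0
  have r0i := ind_integrable h.int0
  set μ := volume.restrict (Ioo 0 T) with hμ
  set M : ℝ → ℝ → ℝ := fun t x => ∫ y in Iic x, indicator (Ioo 0 L) (ρ t) y with hM
  set M0 : ℝ → ℝ := fun x => ∫ y in Iic x, indicator (Ioo 0 L) ρ0 y with hM0
  have Mm : Measurable (fun p : ℝ × ℝ => M p.1 p.2) := meas_Iic h.rmeas
  have M0c : Continuous M0 := Iic_cont r0i
  have eq1 : ∀ᵐ x, ∀ᵐ t ∂μ, M t x = M0 x - ∫ s in Ioo 0 t, w (s, x) := by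
    have := h.integrated h0 w0 wae wi
    refine (Measure.ae_ae_comm ?_).1 this
    exact measurableSet_eq_fun Mm ((M0c.measurable.comp measurable_snd).sub (meas_Ioo wm))
  -- translation
  have qmp : Measure.QuasiMeasurePreserving (fun x : ℝ => x - ε) volume volume :=
    (measurePreserving_sub_right volume ε).quasiMeasurePreserving
  have eq1' : ∀ᵐ x, ∀ᵐ t ∂μ, M t (x-ε) = M0 (x-ε) - ∫ s in Ioo 0 t, w (s, x-ε) := qmp.ae eq1
  have wx : ∀ᵐ x, Integrable (fun s => w (s, x)) μ := wi.prod_left_ae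
  have wx' : ∀ᵐ x, Integrable (fun s => w (s, x-ε)) μ := qmp.ae wx
  set a : ℝ × ℝ → ℝ := fun p => (M p.1 p.2 - M p.1 (p.2-ε)) / ε with ha
  set a0 : ℝ → ℝ := fun x => (M0 x - M0 (x-ε)) / ε with ha0
  have am : Measurable a :=
    (Mm.sub (Mm.comp (measurable_fst.prodMk (measurable_snd.sub_const ε)))).div_const ε
  have a0c : Continuous a0 := (M0c.sub (M0c.comp (continuous_id.sub continuous_const))).div_const ε
  set κ : ℝ × ℝ → ℝ := fun p => -((w p - w (p.1, p.2-ε)) / ε) with hκ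
  have κm : Measurable κ :=
    ((wm.sub (wm.comp (measurable_fst.prodMk (measurable_snd.sub_const ε)))).div_const ε).neg
  have wi' : Integrable (fun p : ℝ × ℝ => w (p.1, p.2-ε)) (μ.prod volume) := by
    have mp : MeasurePreserving (Prod.map id (fun x : ℝ => x - ε)) (μ.prod volume) (μ.prod volume) :=
      (MeasurePreserving.id μ).prod (measurePreserving_sub_right volume ε)
    exact mp.integrable_comp_of_integrable wi
  have κi : Integrable κ (μ.prod volume) := ((wi.sub wi').div_const ε).neg
  set q : ℝ × ℝ → ℝ := fun p => b' (a p) * κ p with hq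
  have qm : Measurable q := (hb'c.measurable.comp am).mul κm
  have qi : Integrable q (μ.prod volume) :=
    κi.bdd_mul (hb'c.measurable.comp am).aestronglyMeasurable (ae_of_all _ fun p => hK _)
  have eq2 : ∀ᵐ x, ∀ᵐ t ∂μ, b (a (t, x)) = b (a0 x) + ∫ s in Ioo 0 t, q (s, x) := by
    filter_upwards [eq1, eq1', wx, wx'] with x h1 h2 h3 h4
    have κx : Integrable (fun s => κ (s, x)) μ := ((h3.sub h4).div_const ε).neg
    have prim : ∀ᵐ t ∂μ, t ∈ Ioo 0 T ∧ a (t, x) = a0 x + ∫ s in (0:ℝ)..t, κ (s, x) := by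
      filter_upwards [h1, h2, ae_restrict_mem measurableSet_Ioo] with t e1 e2 ht
      refine ⟨ht, ?_⟩
      have sub : Ioo 0 t ⊆ Ioo 0 T := Ioo_subset_Ioo_right ht.2.le
      rw [intervalIntegral.integral_of_le ht.1.le, integral_Ioc_eq_integral_Ioo]
      simp only [ha, ha0, hκ]
      rw [e1, e2, integral_neg, integral_div, integral_sub (IntegrableOn.mono_set h3 sub)
        (IntegrableOn.mono_set h4 sub)]
      ring
    filter_upwards [prim] with t ht
    have sub : Ioo 0 t ⊆ Ioo 0 T := Ioo_subset_Ioo_right ht.1.2.le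
    have ii : IntervalIntegrable (fun s => κ (s, x)) volume 0 t := by
      rw [intervalIntegrable_iff_integrableOn_Ioo_of_le ht.1.1.le]
      exact IntegrableOn.mono_set κx sub
    rw [ht.2, chain_int hb hK ii, intervalIntegral.integral_of_le ht.1.1.le,
      integral_Ioc_eq_integral_Ioo]
    congr 1
    apply integral_congr_ae
    filter_upwards [ae_mono (Measure.restrict_mono sub le_rfl) prim] with s hs
    simp only [hq]
    rw [hs.2]
  have eq3 : ∀ᵐ t ∂μ, ∀ᵐ x, b (a (t, x)) = b (a0 x) + ∫ s in Ioo 0 t, q (s, x) := by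
    refine (Measure.ae_ae_comm ?_).2 eq2
    exact measurableSet_eq_fun (bc.measurable.comp am)
      (((bc.comp a0c).measurable.comp measurable_snd).add (meas_Ioo qm))
  have aeq : ∀ᵐ t ∂μ, Integrable (indicator (Ioo 0 L) (ρ t)) ∧
      ∀ x, a (t, x) = (∫ y in (x-ε)..x, indicator (Ioo 0 L) (ρ t) y) / ε := by
    filter_upwards [h.good] with t ht
    have ri := ind_integrable (h.rint ht.1)
    refine ⟨ri, fun x => ?_⟩
    simp only [ha, hM]
    rw [avg_Iic ri]
  have a0eq : ∀ x, a0 x = (∫ y in (x-ε)..x, indicator (Ioo 0 L) ρ0 y) / ε := by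
    intro x
    simp only [ha0, hM0]
    rw [avg_Iic r0i]
  have Jeq : ∀ᵐ s ∂μ, ∫ x, q (s, x)
      = - ∫ x, b' ((∫ y in (x-ε)..x, indicator (Ioo 0 L) (ρ s) y) / ε) *
      ((indicator (Ioo 0 L) (ρ s) x * u s x
        - indicator (Ioo 0 L) (ρ s) (x-ε) * u s (x-ε)) / ε) := by
    filter_upwards [aeq, wae] with s h1 h2
    rw [← integral_neg]
    apply integral_congr_ae
    filter_upwards [h2, qmp.ae h2] with x e1 e2
    simp only [hq, hκ]
    rw [h1.2, e1, e2]
    ring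
  constructor
  · have m1 : AEStronglyMeasurable (fun s => ∫ x, q (s, x)) μ :=
      qm.aestronglyMeasurable.integral_prod_right'
    refine m1.neg.congr ?_
    filter_upwards [Jeq] with s hs
    simp only [Pi.neg_apply]
    rw [hs, neg_neg]
  · filter_upwards [eq3, aeq, ae_restrict_mem measurableSet_Ioo] with t h1 h2 ht
    have sub : Ioo 0 t ⊆ Ioo 0 T := Ioo_subset_Ioo_right ht.2.le
    have qt : Integrable q ((volume.restrict (Ioo 0 t)).prod volume) :=
      qi.mono_measure (Measure.prod_mono (Measure.restrict_mono sub le_rfl) le_rfl)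
    have e1 : ∫ x, b ((∫ y in (x-ε)..x, indicator (Ioo 0 L) (ρ t) y) / ε)
        = ∫ x, (b ((∫ y in (x-ε)..x, indicator (Ioo 0 L) ρ0 y) / ε) + ∫ s in Ioo 0 t, q (s, x)) := by
      apply integral_congr_ae
      filter_upwards [h1] with x hx
      rw [← h2.2, hx, a0eq]
    rw [e1, integral_add (int_b_avg r0i hε hb hK b0) qt.integral_prod_right,
      integral_integral_swap (f := fun x s => q (s, x)) qt.swap, sub_eq_add_neg, ← integral_neg]
    congr 1
    apply integral_congr_ae
    filter_upwards [ae_mono (Measure.restrict_mono sub le_rfl) Jeq] with s hs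
    rw [hs]

end
end CE

namespace CE
open Filter Topology Set

theorem b_avg_lim {r : ℝ → ℝ} (hr : Integrable r) (nn : ∀ x, 0 ≤ r x) {b b' : ℝ → ℝ} {K : ℝ}
    (hb : ∀ z, HasDerivAt b (b' z) z) (hK : ∀ z, |b' z| ≤ K) (b0 : b 0 = 0) :
    Tendsto (fun n : ℕ => ∫ x, b ((∫ y in (x-1/((n:ℝ)+1))..x, r y) / (1/((n:ℝ)+1)))) atTop
      (𝓝 (∫ x, b (r x))) := by
  have bc : Continuous b := continuous_iff_continuousAt.2 fun z => (hb z).continuousAt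
  have pos : ∀ n : ℕ, (0:ℝ) < 1 / ((n : ℝ) + 1) := fun n => by positivity
  refine gdct (G := fun n x => K * ((∫ y in (x-1/((n:ℝ)+1))..x, r y) / (1/((n:ℝ)+1))))
    (g := fun x => K * r x) (fun n => int_b_avg hr (pos n) hb hK b0)
    (fun n => (avg_int hr (pos n)).1.const_mul K) (hr.const_mul K) (fun n => ?_) ?_ ?_ (fun n => ?_)
  · refine ae_of_all _ fun x => ?_
    have := lip_of_deriv hb hK ((∫ y in (x-1/((n:ℝ)+1))..x, r y) / (1/((n:ℝ)+1))) 0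
    rw [b0, sub_zero, sub_zero] at this
    have nn' : 0 ≤ (∫ y in (x-1/((n:ℝ)+1))..x, r y) / (1/((n:ℝ)+1)) :=
      div_nonneg (intervalIntegral.integral_nonneg (by linarith [pos n]) fun y _ => nn y) (pos n).le
    rwa [abs_of_nonneg nn'] at this
  · filter_upwards [avg_tendsto hr] with x hx
    exact (bc.tendsto _).comp hx.1
  · filter_upwards [avg_tendsto hr] with x hx
    exact hx.1.const_mul K
  · rw [integral_const_mul, integral_const_mul, (avg_int hr (pos n)).2]

theorem ind_b {L : ℝ} (f : ℝ → ℝ) {b : ℝ → ℝ} (b0 : b 0 = 0) :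
    ∫ x, b (indicator (Ioo 0 L) f x) = ∫ x in Ioo 0 L, b (f x) := by
  rw [← integral_indicator measurableSet_Ioo]
  congr 1
  funext x
  by_cases hx : x ∈ Ioo 0 L <;> simp [hx, b0]

section
variable {T L : ℝ} {ρ u ux : ℝ → ℝ → ℝ} {ρ0 : ℝ → ℝ}

/-- the renormalized equation for bounded `b` with bounded derivative -/
theorem Sol.renorm (h : Sol T L ρ u ux ρ0) (h0 : ∫ x in Ioo 0 L, ρ0 x ≠ 0)
    {b b' : ℝ → ℝ} {K : ℝ} (hb : ∀ z, HasDerivAt b (b' z) z) (hb'c : Continuous b')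
    (hK : ∀ z, |b' z| ≤ K) (hK' : ∀ z, |b z| ≤ K) (b0 : b 0 = 0) :
    AEStronglyMeasurable (fun s => ∫ x in Ioo 0 L, (b' (ρ s x) * ρ s x - b (ρ s x)) * ux s x)
      (volume.restrict (Ioo 0 T)) ∧
    ∀ᵐ t ∂volume.restrict (Ioo 0 T),
      ∫ x in Ioo 0 L, b (ρ t x) = (∫ x in Ioo 0 L, b (ρ0 x))
        - ∫ s in Ioo 0 t, ∫ x in Ioo 0 L, (b' (ρ s x) * ρ s x - b (ρ s x)) * ux s x := by
  have pos : ∀ n : ℕ, (0:ℝ) < 1 / ((n : ℝ) + 1) := fun n => by positivity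
  have re := fun n : ℕ => h.renorm_eps h0 hb hb'c hK b0 (pos n)
  set J : ℕ → ℝ → ℝ := fun n s =>
    ∫ x, b' ((∫ y in (x-1/((n:ℝ)+1))..x, indicator (Ioo 0 L) (ρ s) y) / (1/((n:ℝ)+1))) *
      ((indicator (Ioo 0 L) (ρ s) x * u s x
        - indicator (Ioo 0 L) (ρ s) (x-1/((n:ℝ)+1)) * u s (x-1/((n:ℝ)+1))) / (1/((n:ℝ)+1))) with hJ
  have sm : ∀ᵐ s ∂volume.restrict (Ioo 0 T),
      (∀ n, ‖J n s‖ ≤ K * ((∫ x in Ioo 0 L, ρ s x ^ 2) +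
        (2 * ∫ x in Ioo 0 L, (u s x ^ 2 + ux s x ^ 2)) + L)) ∧
      Tendsto (fun n => J n s) atTop
        (𝓝 (∫ x in Ioo 0 L, (b' (ρ s x) * ρ s x - b (ρ s x)) * ux s x)) := by
    filter_upwards [h.good] with s hs
    have e2 : (fun x => indicator (Ioo 0 L) (ρ s) x ^ 2) = indicator (Ioo 0 L) (fun x => ρ s x ^ 2) := by
      funext x
      by_cases hx : x ∈ Ioo 0 L <;> simp [hx]
    have main := space_main h.hL (r := indicator (Ioo 0 L) (ρ s))
      ((h.measx s).indicator measurableSet_Ioo) (ind0 _) (by rw [e2]; exact ind_integrable hs.1)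
      (h.hu s) (h.bc s).1 (h.bc s).2 hs.2 hb hb'c hK hK'
    rw [e2, integral_indicator measurableSet_Ioo] at main
    refine ⟨fun n => main.1 _ (pos n), ?_⟩
    have e3 : ∫ x in Ioo 0 L, (b' (indicator (Ioo 0 L) (ρ s) x) * indicator (Ioo 0 L) (ρ s) x
        - b (indicator (Ioo 0 L) (ρ s) x)) * ux s x
        = ∫ x in Ioo 0 L, (b' (ρ s x) * ρ s x - b (ρ s x)) * ux s x :=
      setIntegral_congr_fun measurableSet_Ioo fun x hx => by simp only [indicator_of_mem hx]
    rw [← e3]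
    exact main.2
  have dom : IntegrableOn (fun s => K * ((∫ x in Ioo 0 L, ρ s x ^ 2) +
        (2 * ∫ x in Ioo 0 L, (u s x ^ 2 + ux s x ^ 2)) + L)) (Ioo 0 T) :=
    ((h.S_int.add (h.U_int.const_mul 2)).add (integrable_const L)).const_mul K
  refine ⟨aestronglyMeasurable_of_tendsto_ae atTop (fun n => (re n).1) (sm.mono fun s hs => hs.2), ?_⟩
  filter_upwards [ae_all_iff.2 fun n => (re n).2, h.good, ae_restrict_mem measurableSet_Ioo]
    with t h1 hg ht
  have sub : Ioo 0 t ⊆ Ioo 0 T := Ioo_subset_Ioo_right ht.2.le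
  have nnr : ∀ (f : ℝ → ℝ), (∀ x, 0 ≤ f x) → ∀ x, 0 ≤ indicator (Ioo 0 L) f x := fun f hf x =>
    indicator_nonneg (fun y _ => hf y) x
  have l1 := b_avg_lim (ind_integrable (h.rint hg.1)) (nnr _ (h.nn t)) hb hK b0
  have l2 := b_avg_lim (ind_integrable h.int0) (nnr _ h.nn0) hb hK b0
  rw [ind_b _ b0] at l1 l2
  have l3 : Tendsto (fun n => ∫ s in Ioo 0 t, J n s) atTop
      (𝓝 (∫ s in Ioo 0 t, ∫ x in Ioo 0 L, (b' (ρ s x) * ρ s x - b (ρ s x)) * ux s x)) := by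
    have mm := Measure.restrict_mono (μ := volume) sub le_rfl
    refine tendsto_integral_of_dominated_convergence _
      (fun n => (re n).1.mono_measure mm) (dom.mono_set sub) (fun n => ?_) ?_
    · exact ae_mono mm (sm.mono fun s hs => hs.1 n)
    · exact ae_mono mm (sm.mono fun s hs => hs.2)
  exact tendsto_nhds_unique l1 ((l2.sub l3).congr fun n => (h1 n).symm)

end
end CE

namespace CE
open Filter Topology Set

/-- numerator of the regularization -/
def Nn (δ z : ℝ) : ℝ := δ + (1-δ) * z^2 + δ * z^4
/-- denominator of the regularization -/
def Dd (δ z : ℝ) : ℝ := 1 + δ * z^4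
/-- the correction factor -/
noncomputable def ss (δ z : ℝ) : ℝ := ((1-δ) * z^2 + 2 * δ * z^4) / Nn δ z - 2 * δ * z^4 / Dd δ z
/-- the bounded regularization of `z log z` -/
noncomputable def bb (δ z : ℝ) : ℝ := z / 2 * (Real.log (Nn δ z) - Real.log (Dd δ z))
/-- its derivative -/
noncomputable def bb' (δ z : ℝ) : ℝ := (Real.log (Nn δ z) - Real.log (Dd δ z)) / 2 + ss δ z

section
variable {δ : ℝ}

theorem Nn_ge (h0 : 0 < δ) (h1 : δ < 1) (z : ℝ) : δ ≤ Nn δ z := by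
  unfold Nn
  have : 0 ≤ (1-δ) * z^2 := mul_nonneg (by linarith) (sq_nonneg z)
  have : 0 ≤ δ * z^4 := by positivity
  linarith

theorem Nn_pos (h0 : 0 < δ) (h1 : δ < 1) (z : ℝ) : 0 < Nn δ z := h0.trans_le (Nn_ge h0 h1 z)

theorem Dd_pos (h0 : 0 < δ) (z : ℝ) : 0 < Dd δ z := by unfold Dd; positivity

theorem ss_bound (h0 : 0 < δ) (h1 : δ < 1) (z : ℝ) : |ss δ z| ≤ 2 := by
  have p : 0 ≤ (1-δ) * z^2 := mul_nonneg (by linarith) (sq_nonneg z)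
  have q : 0 ≤ δ * z^4 := by positivity
  have a1 : 0 ≤ ((1-δ) * z^2 + 2 * δ * z^4) / Nn δ z :=
    div_nonneg (by linarith) (Nn_pos h0 h1 z).le
  have a2 : ((1-δ) * z^2 + 2 * δ * z^4) / Nn δ z ≤ 2 := by
    rw [div_le_iff₀ (Nn_pos h0 h1 z)]
    unfold Nn; linarith
  have a3 : 0 ≤ 2 * δ * z^4 / Dd δ z := div_nonneg (by linarith) (Dd_pos h0 z).le
  have a4 : 2 * δ * z^4 / Dd δ z ≤ 2 := by
    rw [div_le_iff₀ (Dd_pos h0 z)]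
    unfold Dd; linarith
  unfold ss
  rw [abs_le]; constructor <;> linarith

theorem bb_deriv (h0 : 0 < δ) (h1 : δ < 1) (z : ℝ) : HasDerivAt (bb δ) (bb' δ z) z := by
  have dN : HasDerivAt (Nn δ) ((1-δ) * (2*z) + δ * (4*z^3)) z := by
    have := (((hasDerivAt_pow 2 z).const_mul (1-δ)).const_add δ).add ((hasDerivAt_pow 4 z).const_mul δ)
    refine this.congr_deriv ?_
    norm_num
  have dD : HasDerivAt (Dd δ) (δ * (4*z^3)) z := by
    have := ((hasDerivAt_pow 4 z).const_mul δ).const_add 1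
    refine this.congr_deriv ?_
    norm_num
  have d := ((hasDerivAt_id z).div_const 2).mul
    ((dN.log (Nn_pos h0 h1 z).ne').sub (dD.log (Dd_pos h0 z).ne'))
  refine d.congr_deriv ?_
  unfold bb' ss
  have := (Nn_pos h0 h1 z).ne'
  have := (Dd_pos h0 z).ne'
  simp only [id, Pi.sub_apply]
  field_simp
  ring

theorem bb'_cont (h0 : 0 < δ) (h1 : δ < 1) : Continuous (bb' δ) := by
  have cN : Continuous (Nn δ) := by unfold Nn; fun_prop
  have cD : Continuous (Dd δ) := by unfold Dd; fun_prop
  unfold bb' ss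
  refine (((cN.log fun z => (Nn_pos h0 h1 z).ne').sub (cD.log fun z => (Dd_pos h0 z).ne')).div_const 2).add
    (Continuous.sub (Continuous.div (by fun_prop) cN fun z => (Nn_pos h0 h1 z).ne')
      (Continuous.div (by fun_prop) cD fun z => (Dd_pos h0 z).ne'))

theorem log_bound (h0 : 0 < δ) (h1 : δ < 1) (z : ℝ) :
    |Real.log (Nn δ z) - Real.log (Dd δ z)| ≤ |Real.log δ| + |Real.log (1 + 1/δ)| := by
  have Np := Nn_pos h0 h1 z
  have Dp := Dd_pos h0 z
  have l1 : Real.log (Nn δ z) ≤ Real.log (1 + 1/δ) + Real.log (Dd δ z) := by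
    rw [← Real.log_mul (by positivity) Dp.ne']
    apply Real.log_le_log Np
    have e : (1 + 1/δ) * Dd δ z = 1 + δ * z^4 + 1/δ + z^4 := by unfold Dd; field_simp; ring
    rw [e]
    unfold Nn
    have : 0 < 1/δ := by positivity
    nlinarith [sq_nonneg (z^2-1), sq_nonneg z, sq_nonneg (z^2)]
  have l2 : Real.log δ + Real.log (Dd δ z) ≤ Real.log (Nn δ z) := by
    rw [← Real.log_mul h0.ne' Dp.ne']
    apply Real.log_le_log (by positivity)
    unfold Nn Dd
    have : 0 ≤ (1-δ) * z^2 := mul_nonneg (by linarith) (sq_nonneg z)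
    have : 0 ≤ δ * (1-δ) * z^4 := mul_nonneg (mul_nonneg h0.le (by linarith)) (by positivity)
    linarith
  have := neg_abs_le (Real.log δ)
  have := le_abs_self (Real.log (1+1/δ))
  have := abs_nonneg (Real.log δ)
  have := abs_nonneg (Real.log (1+1/δ))
  rw [abs_le]; constructor <;> linarith

theorem bb_bound (h0 : 0 < δ) (h1 : δ < 1) : ∃ K, (∀ z, |bb' δ z| ≤ K) ∧ ∀ z, |bb δ z| ≤ K := by
  set C := |Real.log δ| + |Real.log (1 + 1/δ)| with hC
  have C0 : 0 ≤ C := by positivity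
  have i0 : 0 < 1/δ := by positivity
  refine ⟨C + 2 + 1/δ, fun z => ?_, fun z => ?_⟩
  · unfold bb'
    have a := log_bound h0 h1 z
    have b := ss_bound h0 h1 z
    refine (abs_add_le _ _).trans ?_
    rw [abs_div, abs_two]
    linarith
  · have Np := Nn_pos h0 h1 z
    have Dp := Dd_pos h0 z
    have a := log_bound h0 h1 z
    unfold bb
    rw [abs_mul, abs_div, abs_two]
    rcases le_total (|z|) 1 with hz | hz
    · have : |z| / 2 * |Real.log (Nn δ z) - Real.log (Dd δ z)| ≤ 1 * C :=
        mul_le_mul (by linarith) a (abs_nonneg _) (by norm_num)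
      linarith
    · have hz2 : 1 ≤ z^2 := by rw [← sq_abs]; nlinarith
      have hND : Dd δ z ≤ Nn δ z := by unfold Nn Dd; nlinarith
      have lnn : 0 ≤ Real.log (Nn δ z) - Real.log (Dd δ z) := by
        have := Real.log_le_log Dp hND
        linarith
      have lle : Real.log (Nn δ z) - Real.log (Dd δ z) ≤ z^2 / Dd δ z := by
        rw [← Real.log_div Np.ne' Dp.ne']
        refine (Real.log_le_sub_one_of_pos (by positivity)).trans ?_
        rw [div_sub_one Dp.ne']
        apply div_le_div_of_nonneg_right _ Dp.le
        unfold Nn Dd; nlinarith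
      rw [abs_of_nonneg lnn]
      have : |z| / 2 * (Real.log (Nn δ z) - Real.log (Dd δ z)) ≤ |z| * (z^2 / Dd δ z) :=
        mul_le_mul (by linarith) lle lnn (by linarith)
      have k : |z| * (z^2 / Dd δ z) ≤ 1/δ := by
        rw [← mul_div_assoc, div_le_div_iff₀ Dp h0]
        have e : |z|^4 = z^4 := by rw [show |z|^4 = (|z|^2)^2 by ring, sq_abs]; ring
        rw [← sq_abs z]
        unfold Dd
        rw [← e]
        have : |z|^3 ≤ |z|^4 := pow_le_pow_right₀ hz (by norm_num)
        nlinarith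
      linarith

theorem bb_le (h0 : 0 < δ) (h1 : δ < 1) {z : ℝ} (hz : 0 ≤ z) : |bb δ z| ≤ |z * Real.log z| := by
  rcases hz.eq_or_lt with rfl | hz
  · simp [bb]
  have Np := Nn_pos h0 h1 z
  have Dp := Dd_pos h0 z
  have e2 : Real.log (z^2) = 2 * Real.log z := by simp
  unfold bb
  rw [abs_mul, abs_mul, abs_div, abs_two]
  have : |Real.log (Nn δ z) - Real.log (Dd δ z)| ≤ 2 * |Real.log z| := by
    have z2 : 0 < z^2 := by positivity
    have key : z^2 * Dd δ z - Nn δ z = δ * (z^2-1) * (1 + z^4) := by unfold Nn Dd; ring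
    have key2 : Nn δ z - Dd δ z = (1-δ) * (z^2-1) := by unfold Nn Dd; ring
    have lm : Real.log (z^2 * Dd δ z) = 2 * Real.log z + Real.log (Dd δ z) := by
      rw [Real.log_mul z2.ne' Dp.ne', e2]
    rcases le_total 1 (z^2) with h | h
    · have a1 : Dd δ z ≤ Nn δ z := by nlinarith
      have a2 : Nn δ z ≤ z^2 * Dd δ z := by
        have : 0 ≤ δ * (z^2-1) * (1 + z^4) := mul_nonneg (mul_nonneg h0.le (by linarith)) (by positivity)
        linarith
      have b1 := Real.log_le_log Dp a1
      have b2 := Real.log_le_log Np a2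
      rw [lm] at b2
      rw [abs_of_nonneg (by linarith)]
      have := le_abs_self (Real.log z)
      linarith
    · have a1 : Nn δ z ≤ Dd δ z := by nlinarith
      have a2 : z^2 * Dd δ z ≤ Nn δ z := by
        have : 0 ≤ δ * (1-z^2) * (1 + z^4) := mul_nonneg (mul_nonneg h0.le (by linarith)) (by positivity)
        linarith
      have b1 := Real.log_le_log Np a1
      have b2 := Real.log_le_log (by positivity) a2
      rw [lm] at b2
      rw [abs_of_nonpos (by linarith)]
      have := neg_abs_le (Real.log z)
      linarith
  have hz' := abs_nonneg z
  calc |z| / 2 * |Real.log (Nn δ z) - Real.log (Dd δ z)| ≤ |z| / 2 * (2 * |Real.log z|) :=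
        mul_le_mul_of_nonneg_left this (by positivity)
    _ = |z| * |Real.log z| := by ring

theorem bb_comm (z : ℝ) : bb' δ z * z - bb δ z = z * ss δ z := by
  unfold bb' bb; ring

theorem Nn_lim {δn : ℕ → ℝ} (hδ : Tendsto δn atTop (𝓝 0)) (z : ℝ) :
    Tendsto (fun n => Nn (δn n) z) atTop (𝓝 (z^2)) := by
  have : Continuous (fun d => Nn d z) := by unfold Nn; fun_prop
  have := (this.tendsto 0).comp hδ
  simpa [Nn, Function.comp_def] using this

theorem Dd_lim {δn : ℕ → ℝ} (hδ : Tendsto δn atTop (𝓝 0)) (z : ℝ) :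
    Tendsto (fun n => Dd (δn n) z) atTop (𝓝 1) := by
  have : Continuous (fun d => Dd d z) := by unfold Dd; fun_prop
  have := (this.tendsto 0).comp hδ
  simpa [Dd, Function.comp_def] using this

theorem bb_lim {δn : ℕ → ℝ} (hδ : Tendsto δn atTop (𝓝 0)) {z : ℝ} (hz : 0 ≤ z) :
    Tendsto (fun n => bb (δn n) z) atTop (𝓝 (z * Real.log z)) := by
  rcases hz.eq_or_lt with rfl | hz
  · simp [bb]
  have l := (((Nn_lim hδ z).log (by positivity)).sub ((Dd_lim hδ z).log one_ne_zero)).const_mul (z/2)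
  have e : z / 2 * (Real.log (z^2) - Real.log 1) = z * Real.log z := by
    simp only [Real.log_pow, Real.log_one]; push_cast; ring
  rw [e] at l
  exact l

theorem ss_lim {δn : ℕ → ℝ} (hδ : Tendsto δn atTop (𝓝 0)) {z : ℝ} (hz : 0 ≤ z) :
    Tendsto (fun n => z * ss (δn n) z) atTop (𝓝 z) := by
  rcases hz.eq_or_lt with rfl | hz
  · simp
  have c1 : Tendsto (fun n => (1-δn n) * z^2 + 2 * δn n * z^4) atTop (𝓝 ((1-0)*z^2 + 2 * 0 * z^4)) :=
    ((hδ.const_sub 1).mul_const _).add ((hδ.const_mul 2).mul_const _)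
  have c2 : Tendsto (fun n => 2 * δn n * z^4) atTop (𝓝 (2 * 0 * z^4)) := (hδ.const_mul 2).mul_const _
  have l := ((c1.div (Nn_lim hδ z) (by positivity)).sub (c2.div (Dd_lim hδ z) one_ne_zero)).const_mul z
  have e : z * (((1-0)*z^2 + 2 * 0 * z^4) / z^2 - 2 * 0 * z^4 / 1) = z := by
    field_simp; ring
  rw [e] at l
  exact l

end

section
variable {T L : ℝ} {ρ u ux : ℝ → ℝ → ℝ} {ρ0 : ℝ → ℝ}

theorem xlogx_le {z : ℝ} (hz : 0 ≤ z) : |z * Real.log z| ≤ z^2 + 1 := by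
  rcases hz.eq_or_lt with rfl | hz
  · simp
  have a := Real.log_le_sub_one_of_pos hz
  have b := Real.log_le_sub_one_of_pos (inv_pos.2 hz)
  rw [Real.log_inv] at b
  have c : z * z⁻¹ = 1 := mul_inv_cancel₀ hz.ne'
  rw [abs_le]
  constructor
  · nlinarith [mul_le_mul_of_nonneg_left b hz.le]
  · nlinarith [mul_le_mul_of_nonneg_left a hz.le]

theorem Sol.main (h : Sol T L ρ u ux ρ0) : ∀ᵐ t ∂volume.restrict (Ioo 0 T),
      ∫ x in Ioo 0 L, ρ t x * Real.log (ρ t x)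
        = (∫ x in Ioo 0 L, ρ0 x * Real.log (ρ0 x))
          - ∫ s in Ioo 0 t, ∫ x in Ioo 0 L, ρ s x * ux s x := by
  by_cases h0 : ∫ x in Ioo 0 L, ρ0 x = 0
  · obtain ⟨d1, d2⟩ := h.degenerate h0
    have z0 : ∫ x in Ioo 0 L, ρ0 x * Real.log (ρ0 x) = 0 :=
      integral_eq_zero_of_ae (d1.mono fun x hx => by simp [hx])
    filter_upwards [d2, ae_restrict_mem measurableSet_Ioo] with t h1 ht
    have sub : Ioo 0 t ⊆ Ioo 0 T := Ioo_subset_Ioo_right ht.2.le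
    have z1 : ∫ x in Ioo 0 L, ρ t x * Real.log (ρ t x) = 0 :=
      integral_eq_zero_of_ae (h1.mono fun x hx => by simp [hx])
    have z2 : ∫ s in Ioo 0 t, ∫ x in Ioo 0 L, ρ s x * ux s x = 0 := by
      apply integral_eq_zero_of_ae
      filter_upwards [ae_mono (Measure.restrict_mono sub le_rfl) d2] with s hs
      exact integral_eq_zero_of_ae (hs.mono fun x hx => by simp [hx])
    rw [z0, z1, z2, sub_zero]
  · set δ : ℕ → ℝ := fun n => 1 / ((n:ℝ) + 1) / 2 with hδ
    have δ0 : ∀ n, 0 < δ n := fun n => by simp only [hδ]; positivity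
    have δ1 : ∀ n, δ n < 1 := fun n => by
      have : 1 / ((n:ℝ)+1) ≤ 1 := by
        rw [div_le_one (by positivity)]
        have : (0:ℝ) ≤ n := by positivity
        linarith
      simp only [hδ]; linarith
    have δl : Tendsto δ atTop (𝓝 0) := by
      have := eps_tendsto.div_const 2
      rw [zero_div] at this
      exact this
    have bbm : ∀ n, Continuous (bb (δ n)) := fun n =>
      continuous_iff_continuousAt.2 fun z => (bb_deriv (δ0 n) (δ1 n) z).continuousAt
    have ssm : ∀ n, Measurable (fun z => z * ss (δ n) z) := fun n => by
      have : Continuous (fun z => bb' (δ n) z * z - bb (δ n) z) :=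
        ((bb'_cont (δ0 n) (δ1 n)).mul continuous_id).sub (bbm n)
      simp only [bb_comm] at this
      exact this.measurable
    have re : ∀ n, AEStronglyMeasurable (fun s => ∫ x in Ioo 0 L, ρ s x * ss (δ n) (ρ s x) * ux s x)
        (volume.restrict (Ioo 0 T)) ∧
        ∀ᵐ t ∂volume.restrict (Ioo 0 T),
        ∫ x in Ioo 0 L, bb (δ n) (ρ t x) = (∫ x in Ioo 0 L, bb (δ n) (ρ0 x))
        - ∫ s in Ioo 0 t, ∫ x in Ioo 0 L, ρ s x * ss (δ n) (ρ s x) * ux s x := by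
      intro n
      obtain ⟨K, k1, k2⟩ := bb_bound (δ0 n) (δ1 n)
      have := h.renorm h0 (bb_deriv (δ0 n) (δ1 n)) (bb'_cont (δ0 n) (δ1 n)) k1 k2 (by simp [bb])
      simpa only [bb_comm] using this
    have sm : ∀ᵐ s ∂volume.restrict (Ioo 0 T),
        (∀ n, ‖∫ x in Ioo 0 L, ρ s x * ss (δ n) (ρ s x) * ux s x‖ ≤ (∫ x in Ioo 0 L, ρ s x ^ 2) +
          ∫ x in Ioo 0 L, (u s x ^ 2 + ux s x ^ 2)) ∧
        Tendsto (fun n => ∫ x in Ioo 0 L, ρ s x * ss (δ n) (ρ s x) * ux s x) atTop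
          (𝓝 (∫ x in Ioo 0 L, ρ s x * ux s x)) := by
      filter_upwards [h.good] with s hs
      have bd : ∀ n x, ‖ρ s x * ss (δ n) (ρ s x) * ux s x‖ ≤ ρ s x ^ 2 + (u s x ^ 2 + ux s x ^ 2) := by
        intro n x
        have k := ss_bound (δ0 n) (δ1 n) (ρ s x)
        rw [Real.norm_eq_abs, abs_mul, abs_mul, abs_of_nonneg (h.nn s x)]
        have k2 : ρ s x * |ss (δ n) (ρ s x)| * |ux s x| ≤ ρ s x * 2 * |ux s x| :=
          mul_le_mul_of_nonneg_right (mul_le_mul_of_nonneg_left k (h.nn s x)) (abs_nonneg _)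
        nlinarith [sq_nonneg (ρ s x - |ux s x|), sq_abs (ux s x), sq_nonneg (u s x)]
      have ii := hs.1.add hs.2
      refine ⟨fun n => ?_, ?_⟩
      · rw [← integral_add hs.1 hs.2]
        exact norm_integral_le_of_norm_le ii (ae_of_all _ (bd n))
      · refine tendsto_integral_of_dominated_convergence _ (fun n => ?_) ii
          (fun n => ae_of_all _ (bd n)) (ae_of_all _ fun x => ?_)
        · exact (((ssm n).comp (h.measx s)).mul (h.uxmeas s)).aestronglyMeasurable
        · exact (ss_lim δl (h.nn s x)).mul_const _
    filter_upwards [ae_all_iff.2 fun n => (re n).2, h.good, ae_restrict_mem measurableSet_Ioo]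
      with t h1 hg ht
    have sub : Ioo 0 t ⊆ Ioo 0 T := Ioo_subset_Ioo_right ht.2.le
    have mm := Measure.restrict_mono (μ := volume) sub le_rfl
    have li : IntegrableOn (fun x => ρ t x * Real.log (ρ t x)) (Ioo 0 L) := by
      refine (hg.1.add (integrable_const 1)).mono'
        ((h.measx t).mul (h.measx t).log).aestronglyMeasurable (ae_of_all _ fun x => ?_)
      exact xlogx_le (h.nn t x)
    have l1 : Tendsto (fun n => ∫ x in Ioo 0 L, bb (δ n) (ρ t x)) atTop
        (𝓝 (∫ x in Ioo 0 L, ρ t x * Real.log (ρ t x))) := by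
      refine tendsto_integral_of_dominated_convergence _ (fun n => ?_) li.norm
        (fun n => ae_of_all _ fun x => bb_le (δ0 n) (δ1 n) (h.nn t x))
        (ae_of_all _ fun x => bb_lim δl (h.nn t x))
      exact ((bbm n).measurable.comp (h.measx t)).aestronglyMeasurable
    have l2 : Tendsto (fun n => ∫ x in Ioo 0 L, bb (δ n) (ρ0 x)) atTop
        (𝓝 (∫ x in Ioo 0 L, ρ0 x * Real.log (ρ0 x))) := by
      refine tendsto_integral_of_dominated_convergence _ (fun n => ?_) h.log0.norm
        (fun n => ae_of_all _ fun x => bb_le (δ0 n) (δ1 n) (h.nn0 x))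
        (ae_of_all _ fun x => bb_lim δl (h.nn0 x))
      exact (bbm n).comp_aestronglyMeasurable h.int0.aestronglyMeasurable
    have l3 : Tendsto (fun n => ∫ s in Ioo 0 t, ∫ x in Ioo 0 L, ρ s x * ss (δ n) (ρ s x) * ux s x) atTop
        (𝓝 (∫ s in Ioo 0 t, ∫ x in Ioo 0 L, ρ s x * ux s x)) := by
      refine tendsto_integral_of_dominated_convergence _ (fun n => (re n).1.mono_measure mm)
        ((h.S_int.add h.U_int).mono_set sub) (fun n => ?_) ?_
      · exact ae_mono mm (sm.mono fun s hs => hs.1 n)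
      · exact ae_mono mm (sm.mono fun s hs => hs.2)
    exact tendsto_nhds_unique l1 ((l2.sub l3).congr fun n => (h1 n).symm)

end
end CE

/-- Renormalization of weak solutions of the 1D continuity equation with
`B(z) = z log z` (extended by `0` at `z = 0`, as `Real.log 0 = 0`): if
`ρ ∈ L²(0,T;L²(0,L))`, `ρ ≥ 0`, `u ∈ L²(0,T;W₀^{1,2}(0,L))` with spatial derivative
`ux`, and `(ρ,u)` satisfies `ρ_t + (ρu)_x = 0` in the sense of distributions on
`[0,T)×[0,L]` with initial data `ρ₀`, then for a.e. `t ∈ (0,T)`,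
`∫ ρ(t) log ρ(t) dx = ∫ ρ₀ log ρ₀ dx - ∫₀ᵗ ∫ ρ uₓ dx ds`. -/
theorem continuity_equation_entropy_identity (T L : ℝ) (hT : 0 < T) (hL : 0 < L)
    (ρ u ux : ℝ → ℝ → ℝ) (ρ0 : ℝ → ℝ)
    (hρnn : ∀ t x, 0 ≤ ρ t x) (hρ0nn : ∀ x, 0 ≤ ρ0 x)
    (hρmeas : Measurable (fun p : ℝ × ℝ => ρ p.1 p.2))
    (hρL2 : IntegrableOn (fun p : ℝ × ℝ => (ρ p.1 p.2) ^ 2)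
      (Set.Ioo 0 T ×ˢ Set.Ioo 0 L))
    (hu : ∀ t x, HasDerivAt (u t) (ux t x) x)
    (huL2 : IntegrableOn (fun p : ℝ × ℝ => (u p.1 p.2) ^ 2 + (ux p.1 p.2) ^ 2)
      (Set.Ioo 0 T ×ˢ Set.Ioo 0 L))
    (hbc : ∀ t, u t 0 = 0 ∧ u t L = 0)
    (hρ0int : IntegrableOn ρ0 (Set.Ioo 0 L))
    (hρ0log : IntegrableOn (fun x => ρ0 x * Real.log (ρ0 x)) (Set.Ioo 0 L))
    (hweak : ∀ φ : ℝ → ℝ → ℝ, ContDiff ℝ (⊤ : ℕ∞) (fun p : ℝ × ℝ => φ p.1 p.2) →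
      (∃ T' < T, ∀ t x, T' ≤ t → φ t x = 0) →
      (∫ t in Set.Ioo 0 T, ∫ x in Set.Ioo 0 L,
          ρ t x * (deriv (fun s => φ s x) t + u t x * deriv (fun y => φ t y) x))
        + (∫ x in Set.Ioo 0 L, ρ0 x * φ 0 x) = 0) :
    ∀ᵐ t ∂ volume.restrict (Set.Ioo 0 T),
      ∫ x in Set.Ioo 0 L, ρ t x * Real.log (ρ t x)
        = (∫ x in Set.Ioo 0 L, ρ0 x * Real.log (ρ0 x))
          - ∫ s in Set.Ioo 0 t, ∫ x in Set.Ioo 0 L, ρ s x * ux s x := by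
  exact CE.Sol.main ⟨hT, hL, hρnn, hρ0nn, hρmeas, hρL2, hu, huL2, hbc, hρ0int, hρ0log, hweak⟩
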